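/- arXiv:1005.0812 — 3 statements merged into one kernel-verified Lean document; each statement's English description precedes it below -/
import Mathlib

section
/- Assume Conditions B1–B2. Then the law of sup_{t∈T} f(t) is absolutely continuous with respect to Lebesgue measure with density p_{f*}, and there exist a constant c_{f*} and b₀ such that p_{f*}(x) ≤ c_{f*} · x^{d+1} · P( f(0) > x ) for all x > b₀. -/
open MeasureTheory ProbabilityTheory Filter
open scoped Classical

noncomputable section

/-- The ℓ¹ norm `|x| = ∑ⱼ |xⱼ|` on `ℝ^d`. -/
def nrm {d : ℕ} (x : Fin d → ℝ) : ℝ := ∑ j, |x j|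

/-- Subtracting from jointly Gaussian variables their regression on one of them leaves remainders
that are jointly independent of it. -/
theorem indepFun_regression {Ω ι : Type*} [MeasurableSpace Ω] {P : Measure Ω} [Fintype ι]
    {X : ι → Ω → ℝ} (hX : HasGaussianLaw (fun ω i => X i ω) P) (i : ι) (hvar : Var[X i; P] = 1) :
    IndepFun (X i) (fun ω j => X j ω - cov[X j, X i; P] * X i ω) P := by
  have hP := hX.isProbabilityMeasure
  have h2 : ∀ j, MemLp (X j) 2 P := fun j => (hX.eval j).memLp_two
  let L : (ι → ℝ) →L[ℝ] (Unit → ℝ) × (ι → ℝ) :=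
    (ContinuousLinearMap.pi fun _ => ContinuousLinearMap.proj i).prod
      (ContinuousLinearMap.pi fun j => ContinuousLinearMap.proj j -
        cov[X j, X i; P] • ContinuousLinearMap.proj i)
  have hL : HasGaussianLaw (fun ω => ((fun _ : Unit => X i ω),
      (fun j => X j ω - cov[X j, X i; P] * X i ω))) P := hX.map_fun L
  have key := HasGaussianLaw.indepFun_of_covariance_eval
    (X := fun _ : Unit => X i) (Y := fun j ω => X j ω - cov[X j, X i; P] * X i ω) hL ?_
  · exact key.comp (φ := fun x : Unit → ℝ => x ()) (measurable_pi_apply _) measurable_id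
  · intro _ j
    rw [covariance_fun_sub_right (h2 i) (h2 j) ((h2 i).const_mul _),
      covariance_const_mul_right, covariance_self (h2 i).aemeasurable, hvar, covariance_comm]
    ring

theorem variance_eq_of_map_eq_gaussianReal {Ω : Type*} [MeasurableSpace Ω] {P : Measure Ω}
    {X : Ω → ℝ} (hm : Measurable X) {v : NNReal} (h : P.map X = gaussianReal 0 v) :
    Var[X; P] = v := by
  have := variance_id_gaussianReal (μ := 0) (v := v)
  rwa [← h, variance_map aemeasurable_id hm.aemeasurable] at this

theorem covariance_eq_one_sub_half_variance_sub {Ω : Type*} [MeasurableSpace Ω] {P : Measure Ω}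
    [IsProbabilityMeasure P] {X Y : Ω → ℝ} (hX : MemLp X 2 P) (hY : MemLp Y 2 P)
    (hXv : Var[X; P] = 1) (hYv : Var[Y; P] = 1) :
    cov[Y, X; P] = 1 - Var[fun ω => X ω - Y ω; P] / 2 := by
  rw [variance_fun_sub hX hY, hXv, hYv, covariance_comm]
  ring

theorem covariance_le_one {Ω : Type*} [MeasurableSpace Ω] {P : Measure Ω}
    [IsProbabilityMeasure P] {X Y : Ω → ℝ} (hX : MemLp X 2 P) (hY : MemLp Y 2 P)
    (hXv : Var[X; P] = 1) (hYv : Var[Y; P] = 1) : cov[Y, X; P] ≤ 1 := by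
  rw [covariance_eq_one_sub_half_variance_sub hX hY hXv hYv]
  linarith [variance_nonneg (fun ω => X ω - Y ω) P]

/-- Ylvisaker monotonicity: relative to the standard Gaussian law, the law of the maximum of
finitely many jointly Gaussian standard variables has a nondecreasing density. -/
theorem measure_max_mem_mul_le {Ω ι : Type*} [MeasurableSpace Ω] {P : Measure Ω} [Fintype ι]
    [LinearOrder ι] {X : ι → Ω → ℝ} (hX : HasGaussianLaw (fun ω i => X i ω) P)
    (hm : ∀ i, Measurable (X i)) (hlaw : ∀ i, P.map (X i) = gaussianReal 0 1)
    {b : ℝ} {A : Set ℝ} (hA : MeasurableSet A) (hAb : A ⊆ Set.Iic b) :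
    P {ω | ∃ i, X i ω ∈ A ∧ ∀ j, X j ω ≤ X i ω} * gaussianReal 0 1 (Set.Ioi b) ≤
      gaussianReal 0 1 A * P {ω | ∃ i, b < X i ω} := by
  have hP := hX.isProbabilityMeasure
  have h2 : ∀ j, MemLp (X j) 2 P := fun j => (hX.eval j).memLp_two
  have hv : ∀ i, Var[X i; P] = 1 := fun i => by
    simpa using variance_eq_of_map_eq_gaussianReal (hm i) (hlaw i)
  set r : ι → ι → ℝ := fun i j => cov[X j, X i; P] with hr
  have hr1 : ∀ i j, r i j ≤ 1 := fun i j => covariance_le_one (h2 i) (h2 j) (hv i) (hv j)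
  set Z : ι → Ω → ι → ℝ := fun i ω j => X j ω - r i j * X i ω with hZ
  have hind : ∀ i, IndepFun (X i) (Z i) P := fun i => indepFun_regression hX i (hv i)
  set S : ι → ℝ → Set (ι → ℝ) := fun i x =>
    {z | ∀ j, (j < i → z j < (1 - r i j) * x) ∧ z j ≤ (1 - r i j) * x} with hS
  have hSm : ∀ i x, MeasurableSet (S i x) := by
    intro i x
    simp only [hS, Set.ofPred_forall, Set.ofPred_and]
    refine MeasurableSet.iInter fun j => MeasurableSet.inter (MeasurableSet.iInter fun _ => ?_) ?_
    · exact measurableSet_lt (measurable_pi_apply j) measurable_const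
    · exact measurableSet_le (measurable_pi_apply j) measurable_const
  have hSmono : ∀ i x y, x ≤ y → S i x ⊆ S i y := by
    intro i x y hxy z hz j
    have : (1 - r i j) * x ≤ (1 - r i j) * y :=
      mul_le_mul_of_nonneg_left hxy (by linarith [hr1 i j])
    exact ⟨fun h => ((hz j).1 h).trans_le this, (hz j).2.trans this⟩
  set E : ι → Set Ω := fun i => {ω | ∀ j, (j < i → X j ω < X i ω) ∧ X j ω ≤ X i ω} with hE
  have hES : ∀ i ω, ω ∈ E i ↔ Z i ω ∈ S i (X i ω) := by
    intro i ω
    simp only [hE, hS, hZ, Set.mem_ofPred_eq]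
    refine forall_congr' fun j => and_congr (imp_congr_right fun _ => ?_) ?_
    · constructor <;> intro h <;> linarith
    · constructor <;> intro h <;> linarith
  have hEm : ∀ i, MeasurableSet (E i) := by
    intro i
    simp only [hE, Set.ofPred_forall, Set.ofPred_and]
    refine MeasurableSet.iInter fun j => MeasurableSet.inter (MeasurableSet.iInter fun _ => ?_) ?_
    · exact measurableSet_lt (hm j) (hm i)
    · exact measurableSet_le (hm j) (hm i)
  have hstep : ∀ i, P (X i ⁻¹' A ∩ E i) * gaussianReal 0 1 (Set.Ioi b) ≤
      gaussianReal 0 1 A * P (X i ⁻¹' Set.Ioi b ∩ E i) := by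
    intro i
    have h1 : P (X i ⁻¹' A ∩ E i) ≤ gaussianReal 0 1 A * P (Z i ⁻¹' S i b) := by
      rw [← hlaw i, Measure.map_apply (hm i) hA,
        ← (hind i).measure_inter_preimage_eq_mul A (S i b) hA (hSm i b)]
      exact measure_mono fun ω hω =>
        ⟨hω.1, hSmono i _ _ (hAb hω.1) ((hES i ω).1 hω.2)⟩
    have h3 : gaussianReal 0 1 (Set.Ioi b) * P (Z i ⁻¹' S i b) ≤
        P (X i ⁻¹' Set.Ioi b ∩ E i) := by
      rw [← hlaw i, Measure.map_apply (hm i) measurableSet_Ioi,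
        ← (hind i).measure_inter_preimage_eq_mul _ (S i b) measurableSet_Ioi (hSm i b)]
      exact measure_mono fun ω hω =>
        ⟨hω.1, (hES i ω).2 (hSmono i _ _ (le_of_lt hω.1) hω.2)⟩
    calc P (X i ⁻¹' A ∩ E i) * gaussianReal 0 1 (Set.Ioi b)
        ≤ gaussianReal 0 1 A * P (Z i ⁻¹' S i b) * gaussianReal 0 1 (Set.Ioi b) := by gcongr
      _ = gaussianReal 0 1 A * (gaussianReal 0 1 (Set.Ioi b) * P (Z i ⁻¹' S i b)) := by ring
      _ ≤ _ := by gcongr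
  have hsub : {ω | ∃ i, X i ω ∈ A ∧ ∀ j, X j ω ≤ X i ω} ⊆ ⋃ i, X i ⁻¹' A ∩ E i := by
    rintro ω ⟨i₀, hi₀, hmax⟩
    obtain ⟨i, hi, hmin⟩ := Finset.exists_min_image
      (Finset.univ.filter fun i => ∀ j, X j ω ≤ X i ω) id ⟨i₀, by simpa using hmax⟩
    simp only [Finset.mem_filter, Finset.mem_univ, true_and, id] at hi hmin
    refine Set.mem_iUnion.2 ⟨i, ?_, fun j => ⟨fun hji => ?_, hi j⟩⟩
    · have : X i ω = X i₀ ω := le_antisymm (hmax i) (hi i₀)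
      simpa [this] using hi₀
    · by_contra! hcon
      exact absurd (hmin j fun k => (hi k).trans hcon) (not_le.2 hji)
  have hdisj : Pairwise (Function.onFun Disjoint fun i => X i ⁻¹' Set.Ioi b ∩ E i) := by
    intro i j hij
    refine Set.disjoint_left.2 fun ω hi hj => ?_
    rcases lt_or_gt_of_ne hij with h | h
    · exact absurd ((hj.2 i).1 h) (not_lt.2 (hi.2 j).2)
    · exact absurd ((hi.2 j).1 h) (not_lt.2 (hj.2 i).2)
  calc P {ω | ∃ i, X i ω ∈ A ∧ ∀ j, X j ω ≤ X i ω} * gaussianReal 0 1 (Set.Ioi b)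
      ≤ (∑ i, P (X i ⁻¹' A ∩ E i)) * gaussianReal 0 1 (Set.Ioi b) := by
        gcongr
        refine (measure_mono hsub).trans ?_
        simpa using measure_iUnion_le (μ := P) fun i => X i ⁻¹' A ∩ E i
    _ ≤ ∑ i, gaussianReal 0 1 A * P (X i ⁻¹' Set.Ioi b ∩ E i) := by
        rw [Finset.sum_mul]
        exact Finset.sum_le_sum fun i _ => hstep i
    _ = gaussianReal 0 1 A * P (⋃ i, X i ⁻¹' Set.Ioi b ∩ E i) := by
        rw [← Finset.mul_sum, measure_iUnion hdisj
          fun i => (hm i measurableSet_Ioi).inter (hEm i), tsum_fintype]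
    _ ≤ _ := by
        gcongr
        exact Set.iUnion_subset fun i ω hω => ⟨i, hω.1⟩

/-- An upcrossing by a gap `g` between two strongly correlated standard Gaussian variables costs
a sub-Gaussian factor on top of the tail probability. -/
theorem measure_upcrossing_le {Ω : Type*} [MeasurableSpace Ω] {P : Measure Ω} {X Y : Ω → ℝ}
    (hXY : HasGaussianLaw (fun ω => (X ω, Y ω)) P) (hXm : Measurable X) (hYm : Measurable Y)
    (hX : P.map X = gaussianReal 0 1) (hY : P.map Y = gaussianReal 0 1) {c u g : ℝ}
    (hc0 : 0 < c) (hc1 : c ≤ 1) (hu : 0 ≤ u) (hg : 0 ≤ g)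
    (hc : Var[fun ω => X ω - Y ω; P] ≤ c) (hcug : c * u ≤ g / 2) :
    P {ω | u + g < X ω ∧ Y ω ≤ u} ≤
      gaussianReal 0 1 (Set.Ioi (u + g)) * ENNReal.ofReal (Real.exp (-(g / 4) ^ 2 / (2 * c))) := by
  have hP := hXY.isProbabilityMeasure
  have hX2 : MemLp X 2 P := hXY.fst.memLp_two
  have hY2 : MemLp Y 2 P := hXY.snd.memLp_two
  have hXv : Var[X; P] = 1 := by simpa using variance_eq_of_map_eq_gaussianReal hXm hX
  have hYv : Var[Y; P] = 1 := by simpa using variance_eq_of_map_eq_gaussianReal hYm hY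
  have hmean : ∀ {V : Ω → ℝ}, Measurable V → P.map V = gaussianReal 0 1 → ∫ ω, V ω ∂P = 0 := by
    intro V hV h
    have := integral_id_gaussianReal (μ := 0) (v := 1)
    rwa [← h, integral_map hV.aemeasurable (f := fun x : ℝ => x) (by fun_prop)] at this
  set r := cov[Y, X; P] with hr
  have hrD := covariance_eq_one_sub_half_variance_sub hX2 hY2 hXv hYv
  rw [← hr] at hrD
  have hD0 := variance_nonneg (fun ω => X ω - Y ω) P
  have hWlaw : HasGaussianLaw (fun ω => (X ω, r * X ω - Y ω)) P :=
    hXY.map_fun ((ContinuousLinearMap.fst ℝ ℝ ℝ).prod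
      (r • ContinuousLinearMap.fst ℝ ℝ ℝ - ContinuousLinearMap.snd ℝ ℝ ℝ))
  have hind : IndepFun X (fun ω => r * X ω - Y ω) P := by
    refine HasGaussianLaw.indepFun_of_covariance_eq_zero hWlaw ?_
    rw [covariance_fun_sub_right hX2 (hX2.const_mul _) hY2, covariance_const_mul_right,
      covariance_self hXm.aemeasurable, hXv, covariance_comm, hr]
    ring
  have hWm : Measurable fun ω => r * X ω - Y ω := (hXm.const_mul r).sub hYm
  have hWvar : Var[fun ω => r * X ω - Y ω; P] ≤ c := by
    rw [variance_fun_sub (hX2.const_mul _) hY2, variance_const_mul, covariance_const_mul_left,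
      covariance_comm, ← hr, hXv, hYv]
    nlinarith
  have hWmean : ∫ ω, r * X ω - Y ω ∂P = 0 := by
    rw [integral_sub ((hX2.integrable one_le_two).const_mul r) (hY2.integrable one_le_two),
      integral_const_mul, hmean hXm hX, hmean hYm hY]
    simp
  have hW := hWlaw.snd.map_eq_gaussianReal
  rw [hWmean] at hW
  have hsub : HasSubgaussianMGF (fun ω => r * X ω - Y ω) ⟨c, hc0.le⟩ P := by
    refine ⟨fun t => ?_, fun t => ?_⟩
    · have := integrable_exp_mul_gaussianReal (μ := 0)
        (v := Var[fun ω => r * X ω - Y ω; P].toNNReal) t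
      rw [← hW] at this
      exact this.comp_measurable hWm
    · rw [mgf_gaussianReal hW]
      refine Real.exp_le_exp.2 ?_
      rw [Real.coe_toNNReal _ (variance_nonneg _ _)]
      change 0 * t + _ ≤ c * t ^ 2 / 2
      nlinarith [sq_nonneg t]
  have htail := hsub.measure_ge_le (ε := g / 4) (by positivity)
  have hincl : {ω | u + g < X ω ∧ Y ω ≤ u} ⊆
      X ⁻¹' Set.Ioi (u + g) ∩ (fun ω => r * X ω - Y ω) ⁻¹' Set.Ici (g / 4) := by
    rintro ω ⟨h1, h2⟩
    refine ⟨h1, ?_⟩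
    change g / 4 ≤ r * X ω - Y ω
    have : r * (u + g) ≤ r * X ω := mul_le_mul_of_nonneg_left h1.le (by linarith)
    nlinarith
  refine (measure_mono hincl).trans ?_
  rw [hind.measure_inter_preimage_eq_mul _ _ measurableSet_Ioi measurableSet_Ici, ← hX,
    Measure.map_apply hXm measurableSet_Ioi]
  gcongr
  rw [← ofReal_measureReal]
  exact ENNReal.ofReal_le_ofReal htail

theorem gaussianPDFReal_zero_one (x : ℝ) :
    gaussianPDFReal 0 1 x = (√(2 * Real.pi))⁻¹ * Real.exp (-x ^ 2 / 2) := by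
  simp [gaussianPDFReal]

theorem measureReal_gaussianReal (s : Set ℝ) :
    (gaussianReal 0 1).real s = ∫ x in s, gaussianPDFReal 0 1 x := by
  rw [measureReal_def, gaussianReal_apply_eq_integral 0 one_ne_zero, ENNReal.toReal_ofReal]
  exact integral_nonneg fun x => gaussianPDFReal_nonneg 0 1 x

/-- The upper half of the Mills ratio bound. -/
theorem gaussianReal_Ioi_le {u : ℝ} (hu : 0 < u) :
    (gaussianReal 0 1).real (Set.Ioi u) ≤ gaussianPDFReal 0 1 u / u := by
  have hderiv : ∀ x ∈ Set.Ici u, HasDerivAt (fun y => -gaussianPDFReal 0 1 y)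
      (x * gaussianPDFReal 0 1 x) x := by
    intro x _
    simp only [gaussianPDFReal_zero_one]
    have h1 : HasDerivAt (fun y : ℝ => -y ^ 2 / 2) (-x) x :=
      ((hasDerivAt_pow 2 x).neg.div_const 2).congr_deriv (by norm_num; ring)
    exact (h1.exp.const_mul (√(2 * Real.pi))⁻¹).neg.congr_deriv (by ring)
  have hpos : ∀ x ∈ Set.Ioi u, 0 ≤ x * gaussianPDFReal 0 1 x := fun x hx =>
    mul_nonneg (hu.trans hx).le (gaussianPDFReal_nonneg 0 1 x)
  have hlim : Tendsto (fun y => -gaussianPDFReal 0 1 y) atTop (nhds 0) := by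
    simp only [gaussianPDFReal_zero_one]
    have h1 : Tendsto (fun y : ℝ => -y ^ 2 / 2) atTop atBot := by
      have : Tendsto (fun y : ℝ => y ^ 2 / 2) atTop atTop :=
        (tendsto_pow_atTop two_ne_zero).atTop_div_const two_pos
      convert tendsto_neg_atTop_atBot.comp this using 2 with y
      simp [neg_div]
    simpa using ((Real.tendsto_exp_atBot.comp h1).const_mul (√(2 * Real.pi))⁻¹).neg
  have hinteg := integrableOn_Ioi_deriv_of_nonneg' hderiv hpos hlim
  have hval := integral_Ioi_of_hasDerivAt_of_nonneg' hderiv hpos hlim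
  rw [le_div_iff₀ hu, measureReal_gaussianReal, mul_comm, ← integral_const_mul]
  calc ∫ x in Set.Ioi u, u * gaussianPDFReal 0 1 x
      ≤ ∫ x in Set.Ioi u, x * gaussianPDFReal 0 1 x := by
        refine setIntegral_mono_on ((integrable_gaussianPDFReal 0 1).integrableOn.const_mul u)
          hinteg measurableSet_Ioi fun x hx => ?_
        exact mul_le_mul_of_nonneg_right (le_of_lt hx) (gaussianPDFReal_nonneg 0 1 x)
    _ = gaussianPDFReal 0 1 u := by rw [hval]; ring

/-- A crude form of the lower half of the Mills ratio bound. -/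
theorem gaussianPDFReal_le_mul_Ioi {x : ℝ} (hx : 1 ≤ x) :
    gaussianPDFReal 0 1 x ≤ Real.exp (3 / 2) * x * (gaussianReal 0 1).real (Set.Ioi x) := by
  have hx0 : 0 < x := by linarith
  have hinv : x⁻¹ ≤ 1 := inv_le_one_of_one_le₀ hx
  have hinv0 : 0 < x⁻¹ := by positivity
  have h1 : Real.exp (-(3 / 2)) * gaussianPDFReal 0 1 x * x⁻¹ ≤
      (gaussianReal 0 1).real (Set.Ioi x) := by
    calc Real.exp (-(3 / 2)) * gaussianPDFReal 0 1 x * x⁻¹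
        = ∫ _ in Set.Ioc x (x + x⁻¹), Real.exp (-(3 / 2)) * gaussianPDFReal 0 1 x := by
          rw [setIntegral_const, measureReal_def, Real.volume_Ioc, add_sub_cancel_left,
            ENNReal.toReal_ofReal hinv0.le, smul_eq_mul, mul_comm]
      _ ≤ ∫ y in Set.Ioc x (x + x⁻¹), gaussianPDFReal 0 1 y := by
          refine setIntegral_mono_on (integrableOn_const (by simp))
            (integrable_gaussianPDFReal 0 1).integrableOn measurableSet_Ioc fun y hy => ?_
          simp only [gaussianPDFReal_zero_one]
          rw [mul_left_comm, ← Real.exp_add]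
          gcongr
          have hxx : x * x⁻¹ = 1 := mul_inv_cancel₀ hx0.ne'
          have : y ^ 2 ≤ (x + x⁻¹) ^ 2 := by
            have h0 : 0 ≤ y := hx0.le.trans hy.1.le
            have := hy.2
            gcongr
          nlinarith
      _ = (gaussianReal 0 1).real (Set.Ioc x (x + x⁻¹)) := (measureReal_gaussianReal _).symm
      _ ≤ _ := measureReal_mono Set.Ioc_subset_Ioi_self
  calc gaussianPDFReal 0 1 x
      = Real.exp (3 / 2) * x * (Real.exp (-(3 / 2)) * gaussianPDFReal 0 1 x * x⁻¹) := by
        rw [Real.exp_neg]; field_simp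
    _ ≤ _ := by gcongr

theorem gaussianReal_Ioi_sub_le {b : ℝ} (hb : 4 ≤ b) :
    (gaussianReal 0 1).real (Set.Ioi (b - 4 / b)) ≤
      2 * Real.exp (11 / 2) * (gaussianReal 0 1).real (Set.Ioi b) := by
  have hb0 : 0 < b := by linarith
  have h4 : 4 / b ≤ 1 := by rw [div_le_one hb0]; exact hb
  have hbb : b * (4 / b) = 4 := mul_div_cancel₀ 4 hb0.ne'
  have hu : b / 2 ≤ b - 4 / b := by linarith
  have hpdf : gaussianPDFReal 0 1 (b - 4 / b) ≤ Real.exp 4 * gaussianPDFReal 0 1 b := by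
    simp only [gaussianPDFReal_zero_one]
    rw [mul_left_comm, ← Real.exp_add]
    gcongr
    nlinarith [sq_nonneg (4 / b)]
  calc (gaussianReal 0 1).real (Set.Ioi (b - 4 / b))
      ≤ gaussianPDFReal 0 1 (b - 4 / b) / (b - 4 / b) := gaussianReal_Ioi_le (by linarith)
    _ ≤ (Real.exp 4 * gaussianPDFReal 0 1 b) / (b / 2) := by
        have := gaussianPDFReal_nonneg 0 1 b
        gcongr
    _ ≤ (Real.exp 4 * (Real.exp (3 / 2) * b * (gaussianReal 0 1).real (Set.Ioi b))) / (b / 2) := by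
        have := gaussianPDFReal_le_mul_Ioi (x := b) (by linarith)
        gcongr
    _ = _ := by
        rw [show (11 / 2 : ℝ) = 4 + 3 / 2 by norm_num, Real.exp_add]
        field_simp

theorem isGaussianProcess_of_forall_sum {Ω S : Type*} [MeasurableSpace Ω] {P : Measure Ω}
    {f : S → Ω → ℝ} (hm : ∀ t, Measurable (f t))
    (h : ∀ (n : ℕ) (t : Fin n → S) (c : Fin n → ℝ),
      ∃ v : NNReal, P.map (fun ω => ∑ i, c i * f (t i) ω) = gaussianReal 0 v) :
    IsGaussianProcess f P := by
  refine ⟨fun I => ⟨isGaussian_of_map_eq_gaussianReal fun L => ?_⟩⟩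
  have hrm : Measurable fun ω => I.restrict (f · ω) := measurable_pi_lambda _ fun i => hm i
  let e := I.equivFin
  obtain ⟨v, hv⟩ := h I.card (fun i => (e.symm i : S)) (fun i => L (Pi.single (e.symm i) 1))
  refine ⟨0, v, ?_⟩
  rw [Measure.map_map (by fun_prop) hrm, ← hv]
  congr 1
  ext ω
  rw [e.symm.sum_comp fun i : I => L (Pi.single i 1) * f i ω]
  simp only [Function.comp_apply]
  conv_lhs => rw [← L.sum_comp_single]
  refine Finset.sum_congr rfl fun i _ => ?_
  have : (Pi.single i (I.restrict (f · ω) i) : I → ℝ) = f i ω • Pi.single i 1 := by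
    rw [← Pi.single_smul]; simp
  change L (Pi.single i (I.restrict (f · ω) i)) = _
  rw [this, map_smul, smul_eq_mul, mul_comm]

theorem map_eq_standard_gaussian {Ω S : Type*} [AddGroup S] [MeasurableSpace Ω] {P : Measure Ω}
    {f : S → Ω → ℝ} (hm : ∀ t, Measurable (f t))
    (h : ∀ (n : ℕ) (t : Fin n → S) (c : Fin n → ℝ),
      ∃ v : NNReal, P.map (fun ω => ∑ i, c i * f (t i) ω) = gaussianReal 0 v)
    (hvar : (∫ ω, (f 0 ω) ^ 2 ∂P) = 1)
    (hstat : ∀ (n : ℕ) (t : Fin n → S) (h : S),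
      P.map (fun ω (i : Fin n) => f (t i + h) ω) = P.map (fun ω (i : Fin n) => f (t i) ω))
    (t : S) : P.map (f t) = gaussianReal 0 1 := by
  obtain ⟨v, hv⟩ := h 1 (fun _ => 0) (fun _ => 1)
  simp only [Finset.univ_unique, Finset.sum_singleton, one_mul] at hv
  have h1 : (v : ℝ) = 1 := by
    rw [← hvar]
    have h2 := variance_eq_integral (μ := gaussianReal 0 v) (X := fun x => x) (by fun_prop)
    rw [variance_fun_id_gaussianReal, integral_id_gaussianReal, ← hv,
      integral_map (hm 0).aemeasurable (by fun_prop)] at h2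
    simpa using h2
  have hv1 : v = 1 := by exact_mod_cast h1
  have hs := congrArg (Measure.map fun x : Fin 1 → ℝ => x 0) (hstat 1 (fun _ => 0) t)
  rw [Measure.map_map (by fun_prop) (measurable_pi_lambda _ fun _ => hm _),
    Measure.map_map (by fun_prop) (measurable_pi_lambda _ fun _ => hm _)] at hs
  simp only [Function.comp_def, zero_add] at hs
  rw [hs, ← hv1]
  exact hv

theorem integral_cos_mul_gaussianReal (v : NNReal) (s : ℝ) :
    ∫ x, Real.cos (s * x) ∂gaussianReal 0 v = Real.exp (-(v * s ^ 2) / 2) := by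
  have h := charFun_gaussianReal (μ := 0) (v := v) s
  rw [charFun_apply_real] at h
  have hre := congrArg Complex.re h
  have hinteg : Integrable (fun x : ℝ => Complex.exp (s * x * Complex.I)) (gaussianReal 0 v) := by
    refine (integrable_const (1 : ℝ)).mono' (by fun_prop) (ae_of_all _ fun x => ?_)
    rw [← Complex.ofReal_mul, Complex.norm_exp_ofReal_mul_I]
  have h1 : ∫ x : ℝ, (Complex.exp (s * x * Complex.I)).re ∂gaussianReal 0 v =
      (∫ x : ℝ, Complex.exp (s * x * Complex.I) ∂gaussianReal 0 v).re := integral_re hinteg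
  rw [← h1] at hre
  have h2 : ∀ x : ℝ, (Complex.exp (s * x * Complex.I)).re = Real.cos (s * x) := fun x => by
    rw [← Complex.ofReal_mul, Complex.exp_ofReal_mul_I_re]
  simp only [h2] at hre
  rw [hre]
  have h3 : (s * (0 : ℝ) * Complex.I - v * s ^ 2 / 2 : ℂ) = ((-(v * s ^ 2) / 2 : ℝ) : ℂ) := by
    push_cast; ring
  rw [h3, Complex.exp_ofReal_re]

/-- Centered Gaussian variables that converge almost surely have bounded variances. -/
theorem eventually_variance_le_of_tendsto {Ω α : Type*} [MeasurableSpace Ω] {P : Measure Ω}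
    [IsProbabilityMeasure P] {l : Filter α} [l.NeBot] [l.IsCountablyGenerated]
    {D : α → Ω → ℝ} {w : α → NNReal} {D₀ : Ω → ℝ} (hm : ∀ h, Measurable (D h))
    (hlaw : ∀ h, P.map (D h) = gaussianReal 0 (w h))
    (hlim : ∀ᵐ ω ∂P, Tendsto (fun h => D h ω) l (nhds (D₀ ω))) :
    ∃ C : ℝ, ∀ᶠ h in l, (w h : ℝ) ≤ C := by
  have hD₀ : AEMeasurable D₀ P :=
    aemeasurable_of_tendsto_metrizable_ae l (fun h => (hm h).aemeasurable) hlim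
  have hs : Tendsto (fun s : ℝ => ∫ ω, Real.cos (s * D₀ ω) ∂P) (nhdsWithin 0 (Set.Ioi 0))
      (nhds (∫ _, (1 : ℝ) ∂P)) := by
    refine tendsto_integral_filter_of_dominated_convergence (fun _ => 1) ?_ ?_
      (integrable_const 1) ?_
    · exact .of_forall fun s => (Real.measurable_cos.comp_aemeasurable
        (hD₀.const_mul s)).aestronglyMeasurable
    · exact .of_forall fun s => ae_of_all _ fun ω => Real.abs_cos_le_one _
    · refine ae_of_all _ fun ω => ?_
      have : Continuous fun s : ℝ => Real.cos (s * D₀ ω) := by fun_prop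
      simpa using (this.tendsto 0).mono_left nhdsWithin_le_nhds
  rw [integral_const, probReal_univ, one_smul] at hs
  obtain ⟨s, hs1, hs0⟩ :=
    ((hs.eventually (lt_mem_nhds (show (1 / 2 : ℝ) < 1 by norm_num))).and
      self_mem_nhdsWithin).exists
  have hs0 : 0 < s := hs0
  have hl : Tendsto (fun h => ∫ ω, Real.cos (s * D h ω) ∂P) l
      (nhds (∫ ω, Real.cos (s * D₀ ω) ∂P)) := by
    refine tendsto_integral_filter_of_dominated_convergence (fun _ => 1) ?_ ?_
      (integrable_const 1) ?_
    · exact .of_forall fun h => (Real.measurable_cos.comp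
        ((hm h).const_mul s)).aestronglyMeasurable
    · exact .of_forall fun h => ae_of_all _ fun ω => Real.abs_cos_le_one _
    · filter_upwards [hlim] with ω hω
      exact (Real.continuous_cos.tendsto _).comp (hω.const_mul s)
  refine ⟨2 / s ^ 2, ?_⟩
  filter_upwards [hl.eventually (lt_mem_nhds hs1)] with h hh
  have hval : ∫ ω, Real.cos (s * D h ω) ∂P = Real.exp (-(w h * s ^ 2) / 2) := by
    rw [← integral_cos_mul_gaussianReal, ← hlaw h,
      integral_map (hm h).aemeasurable (by fun_prop)]
  rw [hval] at hh
  rw [le_div_iff₀ (by positivity)]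
  by_contra! hcon
  have h1 : Real.exp (-(w h * s ^ 2) / 2) ≤ Real.exp (-1) := Real.exp_le_exp.2 (by linarith)
  have h2 : Real.exp (-1) ≤ 1 / 2 := by
    rw [Real.exp_neg, one_div]
    exact inv_anti₀ two_pos (by linarith [Real.add_one_le_exp 1])
  linarith

theorem eventually_variance_increment_le {Ω E : Type*} [NormedAddCommGroup E] [NormedSpace ℝ E]
    [MeasurableSpace Ω] {P : Measure Ω} [IsProbabilityMeasure P]
    {f : E → Ω → ℝ} (hm : ∀ t, Measurable (f t))
    (h : ∀ (n : ℕ) (t : Fin n → E) (c : Fin n → ℝ),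
      ∃ v : NNReal, P.map (fun ω => ∑ i, c i * f (t i) ω) = gaussianReal 0 v)
    (hstat : ∀ (n : ℕ) (t : Fin n → E) (h : E),
      P.map (fun ω (i : Fin n) => f (t i + h) ω) = P.map (fun ω (i : Fin n) => f (t i) ω))
    (hdiff : ∀ᵐ ω ∂P, DifferentiableAt ℝ (fun t => f t ω) 0) (v : E) :
    ∃ C : ℝ, ∀ᶠ h : ℝ in nhdsWithin 0 (Set.Ioi 0), ∀ t,
      Var[fun ω => f (t + h • v) ω - f t ω; P] ≤ C * h ^ 2 := by
  have hex : ∀ a : ℝ, ∃ w : NNReal,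
      P.map (fun ω => a⁻¹ * (f (a • v) ω - f 0 ω)) = gaussianReal 0 w := by
    intro a
    obtain ⟨w, hw⟩ := h 2 ![a • v, 0] ![a⁻¹, -a⁻¹]
    refine ⟨w, ?_⟩
    rw [← hw]
    congr 1
    ext ω
    simp [Fin.sum_univ_two]
    ring
  choose w hw using hex
  have hDm : ∀ a : ℝ, Measurable fun ω => a⁻¹ * (f (a • v) ω - f 0 ω) := fun a =>
    ((hm _).sub (hm _)).const_mul _
  obtain ⟨C, hC⟩ := eventually_variance_le_of_tendsto (l := nhdsWithin (0 : ℝ) (Set.Ioi 0))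
    (D₀ := fun ω => fderiv ℝ (fun t => f t ω) 0 v) hDm hw (by
      filter_upwards [hdiff] with ω hω
      have h1 := hω.hasFDerivAt.hasLineDerivAt v
      have h2 := h1.tendsto_slope_zero_right
      simpa using h2)
  refine ⟨C, ?_⟩
  filter_upwards [hC, self_mem_nhdsWithin] with a ha ha0 t
  have ha0 : 0 < a := ha0
  have hs := congrArg (Measure.map fun x : Fin 2 → ℝ => x 0 - x 1) (hstat 2 ![a • v, 0] t)
  rw [Measure.map_map (by fun_prop) (measurable_pi_lambda _ fun _ => hm _),
    Measure.map_map (by fun_prop) (measurable_pi_lambda _ fun _ => hm _)] at hs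
  simp only [Function.comp_def, Matrix.cons_val_zero, Matrix.cons_val_one, zero_add] at hs
  have hvar : Var[fun ω => f (t + a • v) ω - f t ω; P] =
      Var[fun ω => f (a • v) ω - f 0 ω; P] := by
    rw [add_comm t]
    have hmd : ∀ s t, AEMeasurable (fun ω => f s ω - f t ω) P := fun s t =>
      ((hm s).sub (hm t)).aemeasurable
    have := congrArg (fun μ => Var[id; μ]) hs
    rwa [variance_map aemeasurable_id (hmd _ _), variance_map aemeasurable_id (hmd _ _)] at this
  have hV := variance_eq_of_map_eq_gaussianReal (hDm a) (hw a)
  rw [variance_const_mul] at hV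
  rw [hvar]
  have : Var[fun ω => f (a • v) ω - f 0 ω; P] = w a * a ^ 2 := by
    rw [← hV]
    field_simp
  rw [this]
  gcongr

/-- A mean-square differentiable stationary field has mean-square Lipschitz increments along the
edges and diagonals of small cubes. -/
theorem exists_variance_cube_increment_le {Ω : Type*} {d : ℕ}
    [MeasurableSpace Ω] {P : Measure Ω} [IsProbabilityMeasure P]
    {f : (Fin d → ℝ) → Ω → ℝ} (hm : ∀ t, Measurable (f t))
    (h : ∀ (n : ℕ) (t : Fin n → (Fin d → ℝ)) (c : Fin n → ℝ),
      ∃ v : NNReal, P.map (fun ω => ∑ i, c i * f (t i) ω) = gaussianReal 0 v)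
    (hstat : ∀ (n : ℕ) (t : Fin n → (Fin d → ℝ)) (h : Fin d → ℝ),
      P.map (fun ω (i : Fin n) => f (t i + h) ω) = P.map (fun ω (i : Fin n) => f (t i) ω))
    (hdiff : ∀ᵐ ω ∂P, DifferentiableAt ℝ (fun t => f t ω) 0) :
    ∃ σ h₀ : ℝ, 1 ≤ σ ∧ 0 < h₀ ∧ ∀ a, 0 < a → a < h₀ → ∀ (e : Fin d → Fin 2) (t : Fin d → ℝ),
      Var[fun ω => f (t + a • fun i => ((e i : ℕ) : ℝ)) ω - f t ω; P] ≤ (σ * a) ^ 2 := by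
  choose C hC using fun e : Fin d → Fin 2 =>
    eventually_variance_increment_le hm h hstat hdiff fun i => ((e i : ℕ) : ℝ)
  have hall := eventually_all.2 hC
  obtain ⟨h₀, h₀pos, hh₀⟩ := mem_nhdsGT_iff_exists_Ioo_subset.1 hall
  have hsum : 0 ≤ ∑ e, |C e| := Finset.sum_nonneg fun _ _ => abs_nonneg _
  refine ⟨1 + ∑ e, |C e|, h₀, by linarith, h₀pos, fun a ha ha' e t => ?_⟩
  refine (hh₀ ⟨ha, ha'⟩ e t).trans ?_
  rw [mul_pow]
  gcongr
  have h1 : |C e| ≤ ∑ e, |C e| :=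
    Finset.single_le_sum (f := fun e => |C e|) (fun _ _ => abs_nonneg _) (Finset.mem_univ e)
  nlinarith [le_abs_self (C e), abs_nonneg (C e)]

/-- The point of the lattice of mesh `a` with integer coordinates `k`. -/
def latticePoint {d : ℕ} (a : ℝ) (k : Fin d → ℤ) : Fin d → ℝ := fun i => a * k i

/-- The integer coordinates of the corner of the cell of mesh `a` containing `t`. -/
def latticeIndex {d : ℕ} (a : ℝ) (t : Fin d → ℝ) : Fin d → ℤ := fun i => ⌊t i / a⌋

theorem latticeIndex_half {d : ℕ} (a : ℝ) (t : Fin d → ℝ) :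
    latticeIndex a t = fun i => latticeIndex (a / 2) t i / 2 := by
  ext i
  have h := Int.floor_div_natCast (t i / (a / 2)) 2
  simp only [latticeIndex]
  rw [show t i / a = t i / (a / 2) / (2 : ℕ) by push_cast; field_simp]
  exact_mod_cast h

theorem latticePoint_half {d : ℕ} (a : ℝ) (k : Fin d → ℤ) :
    ∃ e : Fin d → Fin 2, latticePoint (a / 2) k =
      latticePoint a (fun i => k i / 2) + (a / 2) • fun i => ((e i : ℕ) : ℝ) := by
  have hmod : ∀ i, ∃ e : Fin 2, k i = 2 * (k i / 2) + (e : ℕ) := by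
    intro i
    rcases Int.emod_two_eq_zero_or_one (k i) with h | h
    · exact ⟨0, by simp; omega⟩
    · exact ⟨1, by simp; omega⟩
  choose e he using hmod
  refine ⟨e, funext fun i => ?_⟩
  have hi : (k i : ℝ) = 2 * ((k i / 2 : ℤ) : ℝ) + ((e i : ℕ) : ℝ) := by exact_mod_cast he i
  simp only [latticePoint, Pi.add_apply, Pi.smul_apply, smul_eq_mul]
  rw [hi]
  ring

theorem abs_latticePoint_sub_le {d : ℕ} {a : ℝ} (ha : 0 < a) (t : Fin d → ℝ) (i : Fin d) :
    |latticePoint a (latticeIndex a t) i - t i| ≤ a := by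
  have h1 := Int.floor_le (t i / a)
  have h2 := Int.lt_floor_add_one (t i / a)
  rw [le_div_iff₀ ha] at h1
  rw [div_lt_iff₀ ha] at h2
  simp only [latticePoint, latticeIndex]
  rw [abs_le]
  constructor <;> nlinarith

theorem tendsto_latticePoint {d : ℕ} {a : ℝ} (ha : 0 < a) (t : Fin d → ℝ) :
    Tendsto (fun n : ℕ => latticePoint (a / 2 ^ n) (latticeIndex (a / 2 ^ n) t)) atTop
      (nhds t) := by
  refine tendsto_pi_nhds.2 fun i => ?_
  rw [tendsto_iff_dist_tendsto_zero]
  have hlim : Tendsto (fun n : ℕ => a / 2 ^ n) atTop (nhds 0) := by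
    have := (tendsto_pow_atTop_nhds_zero_of_lt_one (r := (1 / 2 : ℝ)) (by norm_num)
      (by norm_num)).const_mul a
    simpa [div_eq_mul_inv] using this
  exact squeeze_zero (fun _ => dist_nonneg)
    (fun n => abs_latticePoint_sub_le (by positivity) t i) hlim

/-- The lattice cells of mesh `a` meeting a cube of side `2 * R` number at most `(7 * R / a)^d`. -/
theorem exists_finset_latticeIndex {d : ℕ} {R a : ℝ} (hR : 1 ≤ R) (ha : 0 < a) (ha1 : a ≤ 1) :
    ∃ G : Finset (Fin d → ℤ), (∀ t : Fin d → ℝ, (∀ i, |t i| ≤ R) → latticeIndex a t ∈ G) ∧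
      (G.card : ℝ) ≤ (7 * R / a) ^ d := by
  refine ⟨Fintype.piFinset fun _ => Finset.Icc (-(⌈R / a⌉₊ + 1 : ℤ)) (⌈R / a⌉₊ + 1), ?_, ?_⟩
  · intro t ht
    refine Fintype.mem_piFinset.2 fun i => Finset.mem_Icc.2 ?_
    obtain ⟨h1, h2⟩ := abs_le.1 (ht i)
    have hc : R / a ≤ ⌈R / a⌉₊ := Nat.le_ceil _
    have h3 : -(R / a) ≤ t i / a := by rw [← neg_div]; gcongr
    have h4 : t i / a ≤ R / a := by gcongr
    have h5 := Int.floor_le (t i / a)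
    have h6 := Int.lt_floor_add_one (t i / a)
    simp only [latticeIndex]
    constructor
    · have : (-(⌈R / a⌉₊ + 1 : ℤ) : ℝ) ≤ ⌊t i / a⌋ := by push_cast; linarith
      exact_mod_cast this
    · have : (⌊t i / a⌋ : ℝ) ≤ (⌈R / a⌉₊ + 1 : ℤ) := by push_cast; linarith
      exact_mod_cast this
  · rw [Fintype.card_piFinset_const, Int.card_Icc]
    push_cast
    have hRa : 1 ≤ R / a := by rw [le_div_iff₀ ha]; linarith
    have hc := (Nat.ceil_lt_add_one (show 0 ≤ R / a by positivity)).le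
    have h1 : (((⌈R / a⌉₊ : ℤ) + 1 + 1 - -((⌈R / a⌉₊ : ℤ) + 1)).toNat : ℝ) ≤ 7 * R / a := by
      have : ((⌈R / a⌉₊ : ℤ) + 1 + 1 - -((⌈R / a⌉₊ : ℤ) + 1)).toNat = 2 * ⌈R / a⌉₊ + 3 := by
        omega
      rw [this]
      push_cast
      rw [mul_div_assoc]
      linarith
    gcongr

theorem summable_two_pow_mul_exp {d : ℕ} (hd : 0 < d) :
    Summable fun n : ℕ => ((2 : ℝ) ^ (n + 1)) ^ d * Real.exp (-(9 / 4) ^ n / 8) := by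
  have hq : ((8 : ℝ) / 9) ^ d < 1 := pow_lt_one₀ (by norm_num) (by norm_num) hd.ne'
  refine Summable.of_nonneg_of_le (fun n => by positivity) (fun n => ?_)
    ((summable_geometric_of_lt_one (by positivity) hq).mul_left (16 ^ d * d.factorial : ℝ))
  have h := Real.pow_div_factorial_le_exp _ (show (0 : ℝ) ≤ (9 / 4) ^ n / 8 by positivity) d
  have hf : (0 : ℝ) < d.factorial := by exact_mod_cast d.factorial_pos
  rw [neg_div, Real.exp_neg]
  calc ((2 : ℝ) ^ (n + 1)) ^ d * (Real.exp ((9 / 4) ^ n / 8))⁻¹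
      ≤ ((2 : ℝ) ^ (n + 1)) ^ d * (((9 / 4 : ℝ) ^ n / 8) ^ d / (d.factorial : ℝ))⁻¹ := by gcongr
    _ = (2 ^ (n + 1) * (8 / (9 / 4 : ℝ) ^ n)) ^ d * (d.factorial : ℝ) := by
        rw [inv_div, mul_pow, div_pow _ (8 : ℝ), div_pow (8 : ℝ)]
        have hy : (0 : ℝ) < (9 / 4) ^ n := by positivity
        generalize (9 / 4 : ℝ) ^ n = y at hy
        field_simp
    _ = (16 * (8 / 9 : ℝ) ^ n) ^ d * (d.factorial : ℝ) := by
        congr 2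
        rw [show (8 / 9 : ℝ) = 2 / (9 / 4) by norm_num, div_pow 2 (9 / 4 : ℝ) n]
        ring
    _ = _ := by
        rw [mul_pow, ← pow_mul, ← pow_mul, mul_comm n d]
        ring

theorem exists_crossing {x y : ℕ → ℝ} {n : ℕ} (h : x n < y n) :
    x 0 < y 0 ∨ ∃ n, x (n + 1) < y (n + 1) ∧ y n ≤ x n := by
  induction n with
  | zero => exact Or.inl h
  | succ n ih =>
    rcases lt_or_ge (x n) (y n) with h' | h'
    · exact ih h'
    · exact Or.inr ⟨n, h, h'⟩

/-- One step of the chaining argument, between the meshes `(1/(σb))/2^n` and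
`(1/(σb))/2^(n+1)`. -/
theorem measure_lattice_upcrossing_le {Ω : Type*} [MeasurableSpace Ω] {P : Measure Ω}
    [IsProbabilityMeasure P] {d : ℕ} {f : (Fin d → ℝ) → Ω → ℝ} (hG : IsGaussianProcess f P)
    (hm : ∀ t, Measurable (f t)) (hlaw : ∀ t, P.map (f t) = gaussianReal 0 1) {σ h₀ : ℝ}
    (hσ : 1 ≤ σ)
    (hinc : ∀ a, 0 < a → a < h₀ → ∀ (e : Fin d → Fin 2) t,
      Var[fun ω => f (t + a • fun i => ((e i : ℕ) : ℝ)) ω - f t ω; P] ≤ (σ * a) ^ 2)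
    {b : ℝ} (hb : 4 ≤ b) (hbh : 1 / (σ * b) < h₀) (n : ℕ) (k : Fin d → ℤ) :
    P {ω | b - 4 / b * (3 / 4) ^ (n + 1) < f (latticePoint (1 / (σ * b) / 2 ^ (n + 1)) k) ω ∧
      f (latticePoint (1 / (σ * b) / 2 ^ n) fun i => k i / 2) ω ≤ b - 4 / b * (3 / 4) ^ n} ≤
    gaussianReal 0 1 (Set.Ioi (b - 4 / b)) * ENNReal.ofReal (Real.exp (-(9 / 4) ^ n / 8)) := by
  have hσ0 : 0 < σ := by linarith
  have hb0 : 0 < b := by linarith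
  obtain ⟨e, he⟩ := latticePoint_half (1 / (σ * b) / 2 ^ n) k
  rw [show 1 / (σ * b) / 2 ^ n / 2 = 1 / (σ * b) / 2 ^ (n + 1) by
    rw [pow_succ, div_div]] at he
  have ha : 0 < 1 / (σ * b) / 2 ^ (n + 1) := by positivity
  have hah : 1 / (σ * b) / 2 ^ (n + 1) < h₀ :=
    lt_of_le_of_lt (div_le_self (by positivity) (one_le_pow₀ (by norm_num))) hbh
  have hvar := hinc _ ha hah e (latticePoint (1 / (σ * b) / 2 ^ n) fun i => k i / 2)
  rw [← he] at hvar
  have h34 : (0 : ℝ) < (3 / 4) ^ n := by positivity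
  have h34' : ((3 : ℝ) / 4) ^ n ≤ 1 := pow_le_one₀ (by norm_num) (by norm_num)
  have hc : (σ * (1 / (σ * b) / 2 ^ (n + 1))) ^ 2 = (1 / 4) ^ n / (4 * b ^ 2) := by
    rw [show (1 / 4 : ℝ) = (1 / 2) ^ 2 by norm_num, ← pow_mul, mul_comm 2 n, pow_mul, one_div_pow,
      pow_succ 2 n]
    field_simp
    norm_num
  have h14 : (0 : ℝ) < (1 / 4) ^ n := by positivity
  have h14' : ((1 : ℝ) / 4) ^ n ≤ 1 := pow_le_one₀ (by norm_num) (by norm_num)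
  have h1434 : ((1 : ℝ) / 4) ^ n ≤ (3 / 4) ^ n := by gcongr; norm_num
  have h4b : 4 / b ≤ 1 := by rw [div_le_one hb0]; exact hb
  have h4b0 : 0 < 4 / b := by positivity
  have hup := measure_upcrossing_le (P := P)
    (hG.hasGaussianLaw_prodMk (s := latticePoint (1 / (σ * b) / 2 ^ (n + 1)) k)
      (t := latticePoint (1 / (σ * b) / 2 ^ n) fun i => k i / 2)) (hm _) (hm _) (hlaw _) (hlaw _)
    (c := (1 / 4) ^ n / (4 * b ^ 2)) (u := b - 4 / b * (3 / 4) ^ n) (g := (3 / 4) ^ n / b)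
    (by positivity) ?_ ?_ (by positivity) (hc ▸ hvar) ?_
  · have hug : b - 4 / b * (3 / 4) ^ n + (3 / 4) ^ n / b = b - 4 / b * (3 / 4) ^ (n + 1) := by
      rw [pow_succ]; field_simp; ring
    have hexp : -((3 / 4) ^ n / b / 4) ^ 2 / (2 * ((1 / 4) ^ n / (4 * b ^ 2))) =
        -(9 / 4 : ℝ) ^ n / 8 := by
      rw [show (9 / 4 : ℝ) = (3 / 4) * (3 / 4) / (1 / 4) by norm_num, div_pow (3 / 4 * (3 / 4) : ℝ),
        mul_pow]
      generalize (3 / 4 : ℝ) ^ n = y at *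
      generalize (1 / 4 : ℝ) ^ n = z at *
      field_simp
      ring
    rw [hug, hexp] at hup
    refine hup.trans ?_
    gcongr
    have : 4 / b * (3 / 4) ^ (n + 1) ≤ 4 / b :=
      mul_le_of_le_one_right h4b0.le (pow_le_one₀ (by norm_num) (by norm_num))
    linarith
  · rw [div_le_one (by positivity)]; nlinarith
  · nlinarith
  · calc (1 / 4) ^ n / (4 * b ^ 2) * (b - 4 / b * (3 / 4) ^ n)
        ≤ (1 / 4) ^ n / (4 * b ^ 2) * b := by gcongr; nlinarith
      _ = (1 / 4) ^ n / (4 * b) := by field_simp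
      _ ≤ (3 / 4) ^ n / (4 * b) := by gcongr
      _ ≤ _ := by rw [div_div, div_le_div_iff₀ (by positivity) (by positivity)]; nlinarith

theorem measure_exists_gt_le {Ω : Type*} [MeasurableSpace Ω] {P : Measure Ω}
    [IsProbabilityMeasure P] {d : ℕ} (hd : 0 < d) {f : (Fin d → ℝ) → Ω → ℝ}
    (hG : IsGaussianProcess f P) (hm : ∀ t, Measurable (f t))
    (hlaw : ∀ t, P.map (f t) = gaussianReal 0 1)
    (hcont : ∀ᵐ ω ∂P, Continuous fun t => f t ω) {σ h₀ : ℝ} (hσ : 1 ≤ σ) (hh₀ : 0 < h₀)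
    (hinc : ∀ a, 0 < a → a < h₀ → ∀ (e : Fin d → Fin 2) t,
      Var[fun ω => f (t + a • fun i => ((e i : ℕ) : ℝ)) ω - f t ω; P] ≤ (σ * a) ^ 2)
    {R : ℝ} (hR : 1 ≤ R) {T : Set (Fin d → ℝ)} (hT : ∀ t ∈ T, ∀ i, |t i| ≤ R) :
    ∃ C b₀ : ℝ, 0 ≤ C ∧ ∀ b, b₀ ≤ b → P {ω | ∃ t ∈ T, b < f t ω} ≤
      ENNReal.ofReal (C * b ^ d) * gaussianReal 0 1 (Set.Ioi b) := by
  have hσ0 : 0 < σ := by linarith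
  have hsum := summable_two_pow_mul_exp hd
  set S := ∑' n : ℕ, ((2 : ℝ) ^ (n + 1)) ^ d * Real.exp (-(9 / 4) ^ n / 8) with hS
  have hS0 : 0 ≤ S := tsum_nonneg fun n => by positivity
  refine ⟨(7 * R * σ) ^ d * (1 + S) * (2 * Real.exp (11 / 2)), max 4 (2 / (σ * h₀)),
    by positivity, fun b hb => ?_⟩
  have hb4 : 4 ≤ b := (le_max_left _ _).trans hb
  have hb0 : 0 < b := by linarith
  have hbh : 1 / (σ * b) < h₀ := by
    have := (le_max_right _ _).trans hb
    rw [div_le_iff₀ (by positivity)] at this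
    rw [div_lt_iff₀ (by positivity)]
    nlinarith
  set a := 1 / (σ * b) with ha
  have ha0 : 0 < a := by positivity
  have ha1 : a ≤ 1 := by rw [ha, div_le_one (by positivity)]; nlinarith
  have han : ∀ n : ℕ, 0 < a / 2 ^ n := fun n => by positivity
  have han1 : ∀ n : ℕ, a / 2 ^ n ≤ 1 := fun n =>
    (div_le_self ha0.le (one_le_pow₀ (by norm_num))).trans ha1
  choose G hGmem hGcard using fun n =>
    exists_finset_latticeIndex (d := d) hR (han n) (han1 n)
  have hcard : ∀ n, ((G n).card : ℝ) ≤ (7 * R * σ * b) ^ d * (2 ^ n) ^ d := by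
    intro n
    refine (hGcard n).trans_eq ?_
    rw [← mul_pow, ha]
    congr 1
    field_simp
  set γ := gaussianReal 0 1 (Set.Ioi (b - 4 / b)) with hγ
  let E : Set Ω := ⋃ k ∈ G 0, {ω | b - 4 / b < f (latticePoint a k) ω}
  let F : ℕ → Set Ω := fun n => ⋃ k ∈ G (n + 1),
    {ω | b - 4 / b * (3 / 4) ^ (n + 1) < f (latticePoint (a / 2 ^ (n + 1)) k) ω ∧
      f (latticePoint (a / 2 ^ n) fun i => k i / 2) ω ≤ b - 4 / b * (3 / 4) ^ n}
  have hsub : {ω | ∃ t ∈ T, b < f t ω} ≤ᵐ[P] (E ∪ ⋃ n, F n : Set Ω) := by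
    filter_upwards [hcont] with ω hω hmem
    obtain ⟨t, ht, htb⟩ := hmem
    have hlim := (hω.tendsto t).comp (tendsto_latticePoint ha0 t)
    obtain ⟨n, hn⟩ := (hlim.eventually (lt_mem_nhds htb)).exists
    have hn' : b - 4 / b * (3 / 4) ^ n < f (latticePoint (a / 2 ^ n)
        (latticeIndex (a / 2 ^ n) t)) ω := by
      have : 0 < 4 / b * (3 / 4) ^ n := by positivity
      simp only [Function.comp_apply] at hn
      linarith
    rcases exists_crossing (x := fun n => b - 4 / b * (3 / 4) ^ n)
      (y := fun n => f (latticePoint (a / 2 ^ n) (latticeIndex (a / 2 ^ n) t)) ω) hn' with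
      h0 | ⟨m, hm1, hm2⟩
    · refine Or.inl (Set.mem_biUnion (hGmem 0 t (hT t ht)) ?_)
      simpa using h0
    · refine Or.inr (Set.mem_iUnion.2 ⟨m, Set.mem_biUnion (hGmem (m + 1) t (hT t ht)) ⟨hm1, ?_⟩⟩)
      have := latticeIndex_half (a / 2 ^ m) t
      rw [show a / 2 ^ m / 2 = a / 2 ^ (m + 1) by rw [pow_succ]; field_simp] at this
      rw [← this]
      exact hm2
  have hE : P E ≤ ENNReal.ofReal ((7 * R * σ * b) ^ d) * γ := by
    refine (measure_biUnion_finset_le _ _).trans ?_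
    have : ∀ k ∈ G 0, P {ω | b - 4 / b < f (latticePoint a k) ω} ≤ γ := fun k _ => by
      rw [hγ, ← hlaw (latticePoint a k), Measure.map_apply (hm _) measurableSet_Ioi]
      rfl
    refine (Finset.sum_le_card_nsmul _ _ _ this).trans ?_
    rw [nsmul_eq_mul]
    gcongr
    rw [← ENNReal.ofReal_natCast]
    exact ENNReal.ofReal_le_ofReal (by simpa using hcard 0)
  have hF : ∀ n, P (F n) ≤ ENNReal.ofReal ((7 * R * σ * b) ^ d *
      (((2 : ℝ) ^ (n + 1)) ^ d * Real.exp (-(9 / 4) ^ n / 8))) * γ := by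
    intro n
    refine (measure_biUnion_finset_le _ _).trans ?_
    refine (Finset.sum_le_card_nsmul _ _ _ fun k _ =>
      measure_lattice_upcrossing_le hG hm hlaw hσ hinc hb4 hbh n k).trans ?_
    rw [nsmul_eq_mul, ← mul_assoc ((7 * R * σ * b) ^ d),
      ENNReal.ofReal_mul (by positivity), mul_comm (gaussianReal 0 1 _), ← mul_assoc]
    gcongr
    rw [← ENNReal.ofReal_natCast]
    exact ENNReal.ofReal_le_ofReal (hcard (n + 1))
  have hγb : γ ≤ ENNReal.ofReal (2 * Real.exp (11 / 2)) * gaussianReal 0 1 (Set.Ioi b) := by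
    have := gaussianReal_Ioi_sub_le hb4
    rw [hγ, ← ofReal_measureReal (μ := gaussianReal 0 1) (s := Set.Ioi (b - 4 / b)),
      ← ofReal_measureReal (μ := gaussianReal 0 1) (s := Set.Ioi b),
      ← ENNReal.ofReal_mul (by positivity)]
    exact ENNReal.ofReal_le_ofReal this
  calc P {ω | ∃ t ∈ T, b < f t ω} ≤ P (E ∪ ⋃ n, F n) := measure_mono_ae hsub
    _ ≤ P E + ∑' n, P (F n) := (measure_union_le _ _).trans (by gcongr; exact measure_iUnion_le _)
    _ ≤ ENNReal.ofReal ((7 * R * σ * b) ^ d) * γ + ∑' n, ENNReal.ofReal ((7 * R * σ * b) ^ d *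
        (((2 : ℝ) ^ (n + 1)) ^ d * Real.exp (-(9 / 4) ^ n / 8))) * γ :=
      add_le_add hE (ENNReal.tsum_le_tsum hF)
    _ = ENNReal.ofReal ((7 * R * σ * b) ^ d * (1 + S)) * γ := by
      rw [ENNReal.tsum_mul_right, ← ENNReal.ofReal_tsum_of_nonneg (fun n => by positivity)
        (hsum.mul_left _), tsum_mul_left, ← hS, ← add_mul,
        ← ENNReal.ofReal_add (by positivity) (by positivity)]
      congr 2
      ring
    _ ≤ ENNReal.ofReal ((7 * R * σ * b) ^ d * (1 + S)) *
        (ENNReal.ofReal (2 * Real.exp (11 / 2)) * gaussianReal 0 1 (Set.Ioi b)) := by gcongr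
    _ = _ := by
      rw [← mul_assoc, ← ENNReal.ofReal_mul (by positivity)]
      congr 2
      rw [mul_pow _ b]
      ring

theorem hasGaussianLaw_of_fintype {Ω S ι : Type*}
    [MeasurableSpace Ω] {P : Measure Ω} [Fintype ι] {f : S → Ω → ℝ} (hG : IsGaussianProcess f P)
    (u : ι → S) : HasGaussianLaw (fun ω i => f (u i) ω) P := by
  let L : (↥(Finset.univ : Finset ι) → ℝ) →L[ℝ] (ι → ℝ) :=
    ContinuousLinearMap.pi fun i => ContinuousLinearMap.proj ⟨i, Finset.mem_univ i⟩
  have h := ((hG.comp_right u).hasGaussianLaw Finset.univ).map L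
  have heq : (L ∘ fun ω => Finset.univ.restrict fun i => (f ∘ u) i ω) = fun ω i => f (u i) ω := by
    ext ω i
    simp [L]
  rwa [heq] at h

theorem measure_le_of_eventually_mem {Ω : Type*} [MeasurableSpace Ω] {P : Measure Ω}
    {S : ℕ → Set Ω} {E : Set Ω} {K : ENNReal} (hS : ∀ n, P (S n) ≤ K)
    (hE : ∀ᵐ ω ∂P, ω ∈ E → ∀ᶠ n in atTop, ω ∈ S n) : P E ≤ K := by
  have hmono : Monotone fun N : ℕ => ⋂ n ≥ N, S n := fun N M hNM =>
    Set.biInter_subset_biInter_left fun n hn => hNM.trans hn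
  calc P E ≤ P (⋃ N : ℕ, ⋂ n ≥ N, S n) := by
        refine measure_mono_ae ?_
        filter_upwards [hE] with ω hω hmem
        obtain ⟨N, hN⟩ := eventually_atTop.1 (hω hmem)
        exact Set.mem_iUnion.2 ⟨N, Set.mem_iInter₂.2 hN⟩
    _ = ⨆ N : ℕ, P (⋂ n ≥ N, S n) := hmono.measure_iUnion
    _ ≤ K := iSup_le fun N => (measure_mono (Set.biInter_subset_of_mem le_rfl)).trans (hS N)

theorem exists_measurable_max_tendsto_sSup {Ω S : Type*} [MeasurableSpace Ω] [TopologicalSpace S]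
    {f : S → Ω → ℝ} (hm : ∀ t, Measurable (f t)) {T : Set S} [TopologicalSpace.SeparableSpace T]
    (hTc : IsCompact T) (hTn : T.Nonempty) :
    ∃ u : ℕ → S, (∀ n, u n ∈ T) ∧ ∃ M : ℕ → Ω → ℝ, (∀ n, Measurable (M n)) ∧
      (∀ n ω, ∃ i : Fin (n + 1), f (u i) ω = M n ω ∧ ∀ j : Fin (n + 1), f (u j) ω ≤ f (u i) ω) ∧
      ∀ ω, (Continuous fun t => f t ω) →
        Tendsto (fun n => M n ω) atTop (nhds (sSup ((fun t => f t ω) '' T))) := by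
  have hTne : Nonempty T := hTn.to_subtype
  let u : ℕ → S := fun n => TopologicalSpace.denseSeq T n
  have huT : ∀ n, u n ∈ T := fun n => (TopologicalSpace.denseSeq T n).2
  let M : ℕ → Ω → ℝ := fun n => (Finset.univ : Finset (Fin (n + 1))).sup' Finset.univ_nonempty
    fun i => f (u i)
  have hMle : ∀ n ω (i : Fin (n + 1)), f (u i) ω ≤ M n ω := fun n ω i => by
    simp only [M, Finset.sup'_apply]
    exact Finset.le_sup' (fun i : Fin (n + 1) => f (u i) ω) (Finset.mem_univ i)
  have hMeq : ∀ n ω, ∃ i : Fin (n + 1), f (u i) ω = M n ω := fun n ω => by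
    obtain ⟨i, -, hi⟩ := Finset.exists_mem_eq_sup' (Finset.univ_nonempty (α := Fin (n + 1)))
      fun i => f (u i) ω
    exact ⟨i, by simp only [M, Finset.sup'_apply]; exact hi.symm⟩
  refine ⟨u, huT, M, fun n => Finset.measurable_sup' _ fun i _ => hm _, fun n ω => ?_,
    fun ω hω => ?_⟩
  · obtain ⟨i, hi⟩ := hMeq n ω
    exact ⟨i, hi, fun j => hi ▸ hMle n ω j⟩
  · have hbdd : BddAbove ((fun t => f t ω) '' T) := (hTc.image hω).bddAbove
    refine tendsto_order.2 ⟨fun c hc => ?_, fun c hc => Eventually.of_forall fun n => ?_⟩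
    · obtain ⟨_, ⟨t, ht, rfl⟩, hct⟩ := exists_lt_of_lt_csSup (hTn.image _) hc
      have hopen : IsOpen {s : T | c < f s ω} :=
        isOpen_lt continuous_const (hω.comp continuous_subtype_val)
      obtain ⟨k, hk⟩ := (TopologicalSpace.denseRange_denseSeq T).exists_mem_open hopen
        ⟨⟨t, ht⟩, hct⟩
      filter_upwards [eventually_ge_atTop k] with n hn
      exact lt_of_lt_of_le hk (hMle n ω ⟨k, by omega⟩)
    · obtain ⟨i, hi⟩ := hMeq n ω
      exact lt_of_le_of_lt (hi ▸ le_csSup hbdd ⟨u i, huT _, rfl⟩) hc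

/-- Ylvisaker comparison for the supremum of a continuous Gaussian process with standard
marginals. -/
theorem aemeasurable_sSup_and_map_restrict_le {Ω S : Type*} [MeasurableSpace Ω] {P : Measure Ω}
    [TopologicalSpace S] {f : S → Ω → ℝ} (hG : IsGaussianProcess f P)
    (hm : ∀ t, Measurable (f t)) (hlaw : ∀ t, P.map (f t) = gaussianReal 0 1)
    (hcont : ∀ᵐ ω ∂P, Continuous fun t => f t ω) {T : Set S}
    [TopologicalSpace.SeparableSpace T] (hTc : IsCompact T) (hTn : T.Nonempty) :
    AEMeasurable (fun ω => sSup ((fun t => f t ω) '' T)) P ∧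
    ∀ (b : ℝ) (K : NNReal), P {ω | ∃ t ∈ T, b < f t ω} ≤ K * gaussianReal 0 1 (Set.Ioi b) →
      (P.map fun ω => sSup ((fun t => f t ω) '' T)).restrict (Set.Iio b) ≤
        K • gaussianReal 0 1 := by
  obtain ⟨u, huT, M, hMm, hMmax, hMlim⟩ := exists_measurable_max_tendsto_sSup hm hTc hTn
  have hlim : ∀ᵐ ω ∂P, Tendsto (fun n => M n ω) atTop (nhds (sSup ((fun t => f t ω) '' T))) := by
    filter_upwards [hcont] with ω hω using hMlim ω hω
  have hsup := aemeasurable_of_tendsto_metrizable_ae atTop (fun n => (hMm n).aemeasurable) hlim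
  refine ⟨hsup, fun b K hK => ?_⟩
  have hγ0 : gaussianReal 0 1 (Set.Ioi b) ≠ 0 := fun h0 => by
    have := gaussianReal_absolutelyContinuous' 0 one_ne_zero h0
    simp at this
  have hfin : ∀ n (A : Set ℝ), MeasurableSet A → A ⊆ Set.Iic b →
      P {ω | M n ω ∈ A} ≤ K * gaussianReal 0 1 A := by
    intro n A hA hAb
    have h1 := measure_max_mem_mul_le (P := P) (X := fun (i : Fin (n + 1)) ω => f (u i) ω)
      (hasGaussianLaw_of_fintype hG fun i : Fin (n + 1) => u i) (fun i => hm _)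
      (fun i => hlaw _) hA hAb
    have h2 : P {ω | ∃ i : Fin (n + 1), b < f (u i) ω} ≤ K * gaussianReal 0 1 (Set.Ioi b) := by
      refine le_trans (measure_mono fun ω hω => ?_) hK
      obtain ⟨i, hi⟩ := hω
      exact ⟨u i, huT _, hi⟩
    have h3 : P {ω | M n ω ∈ A} ≤
        P {ω | ∃ i : Fin (n + 1), f (u i) ω ∈ A ∧ ∀ j : Fin (n + 1), f (u j) ω ≤ f (u i) ω} := by
      refine measure_mono fun ω hω => ?_
      obtain ⟨i, hi, hmax⟩ := hMmax n ω
      exact ⟨i, by rw [hi]; exact hω, hmax⟩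
    refine (ENNReal.mul_le_mul_iff_left hγ0 (measure_ne_top _ _)).1 ?_
    calc P {ω | M n ω ∈ A} * gaussianReal 0 1 (Set.Ioi b) ≤ _ := mul_le_mul_left h3 _
      _ ≤ _ := h1
      _ ≤ gaussianReal 0 1 A * (K * gaussianReal 0 1 (Set.Ioi b)) := by gcongr
      _ = _ := by ring
  have hopen : ∀ A : Set ℝ, IsOpen A → A ⊆ Set.Iic b →
      (P.map fun ω => sSup ((fun t => f t ω) '' T)) A ≤ K * gaussianReal 0 1 A := by
    intro A hA hAb
    rw [Measure.map_apply_of_aemeasurable hsup hA.measurableSet]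
    refine measure_le_of_eventually_mem (fun n => hfin n A hA.measurableSet hAb) ?_
    filter_upwards [hlim] with ω hω hmem
    exact hω.eventually (hA.mem_nhds hmem)
  refine Measure.le_iff.2 fun A hA => ENNReal.le_of_forall_pos_le_add fun ε hε _ => ?_
  obtain ⟨U, hAU, hU, hUA⟩ := A.exists_isOpen_le_add (gaussianReal 0 1) (ε := ε / K)
    (ENNReal.div_pos (by simpa using hε.ne') (by simp)).ne'
  rw [Measure.restrict_apply hA]
  calc (P.map fun ω => sSup ((fun t => f t ω) '' T)) (A ∩ Set.Iio b)
      ≤ (P.map fun ω => sSup ((fun t => f t ω) '' T)) (U ∩ Set.Iio b) := by gcongr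
    _ ≤ K * gaussianReal 0 1 (U ∩ Set.Iio b) := hopen _ (hU.inter isOpen_Iio)
        (Set.inter_subset_right.trans Set.Iio_subset_Iic_self)
    _ ≤ K * gaussianReal 0 1 U := by gcongr; exact Set.inter_subset_left
    _ ≤ K * (gaussianReal 0 1 A + ε / K) := by gcongr
    _ ≤ K * gaussianReal 0 1 A + ε := by rw [mul_add]; gcongr; exact ENNReal.mul_div_le
    _ = _ := by rw [Measure.smul_apply]; rfl

theorem exists_density_le {μ : Measure ℝ} [IsFiniteMeasure μ] {d : ℕ} {C b₀ : ℝ} (hC : 0 ≤ C)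
    (h : ∀ b, b₀ ≤ b → μ.restrict (Set.Iio b) ≤ (C * b ^ d).toNNReal • gaussianReal 0 1) :
    ∃ p : ℝ → ℝ, μ = volume.withDensity (fun x => ENNReal.ofReal (p x)) ∧
      ∀ x, max b₀ 1 < x → p x ≤ C * 2 ^ d * Real.exp (3 / 2) * x ^ (d + 1) *
        (gaussianReal 0 1).real (Set.Ioi x) := by
  have hγ : gaussianReal 0 1 = volume.withDensity (gaussianPDF 0 1) :=
    gaussianReal_of_var_ne_zero 0 one_ne_zero
  have hγac : gaussianReal 0 1 ≪ volume := gaussianReal_absolutelyContinuous 0 one_ne_zero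
  have hexh : ⋃ n : ℕ, Set.Iio (n + b₀ : ℝ) = Set.univ := by
    refine Set.eq_univ_of_forall fun x => Set.mem_iUnion.2 ?_
    obtain ⟨n, hn⟩ := exists_nat_gt (x - b₀)
    exact ⟨n, by simp only [Set.mem_Iio]; linarith⟩
  have hac : μ ≪ volume := by
    refine Measure.AbsolutelyContinuous.mk fun s hs hs0 => ?_
    rw [← Set.inter_univ s, ← hexh, Set.inter_iUnion]
    refine measure_iUnion_null fun n => ?_
    rw [← Measure.restrict_apply hs]
    refine le_antisymm ((h (n + b₀) (by simp) s).trans ?_) zero_le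
    simp [hγac hs0]
  set q := μ.rnDeriv volume with hq
  have hqm : Measurable q := Measure.measurable_rnDeriv _ _
  have hμ : volume.withDensity q = μ := Measure.withDensity_rnDeriv_eq _ _ hac
  have hqb : ∀ b, b₀ ≤ b → ∀ᵐ x, x ∈ Set.Iio b →
      q x ≤ ENNReal.ofReal (C * b ^ d) * gaussianPDF 0 1 x := by
    intro b hb
    rw [← ae_restrict_iff' measurableSet_Iio]
    refine ae_le_of_forall_setLIntegral_le_of_sigmaFinite hqm fun s hs _ => ?_
    rw [Measure.restrict_restrict hs, lintegral_const_mul _ (measurable_gaussianPDF 0 1),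
      ← withDensity_apply _ (hs.inter measurableSet_Iio),
      ← withDensity_apply _ (hs.inter measurableSet_Iio), hμ, ← hγ]
    have := h b hb (s ∩ Set.Iio b)
    rwa [Measure.restrict_apply (hs.inter measurableSet_Iio), Set.inter_assoc, Set.inter_self]
      at this
  have hqbound : ∀ᵐ x, max b₀ 1 < x → (q x).toReal ≤ C * 2 ^ d * Real.exp (3 / 2) *
      x ^ (d + 1) * (gaussianReal 0 1).real (Set.Ioi x) := by
    have hall : ∀ᵐ x, ∀ n : ℕ, b₀ ≤ n → x ∈ Set.Iio (n : ℝ) →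
        q x ≤ ENNReal.ofReal (C * (n : ℝ) ^ d) * gaussianPDF 0 1 x := by
      refine ae_all_iff.2 fun n => ?_
      by_cases hn : b₀ ≤ n
      · filter_upwards [hqb n hn] with x hx _ using hx
      · exact Eventually.of_forall fun x h' => absurd h' hn
    filter_upwards [hall] with x hx hbx
    have hb₀x : b₀ < x := (le_max_left _ _).trans_lt hbx
    have h1x : 1 < x := (le_max_right _ _).trans_lt hbx
    have hx0 : 0 < x := by linarith
    have hlt : x < ⌊x⌋₊ + 1 := Nat.lt_floor_add_one x
    have hle : (⌊x⌋₊ : ℝ) ≤ x := Nat.floor_le hx0.le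
    have h1 := hx (⌊x⌋₊ + 1) (by push_cast; linarith) (by push_cast; exact hlt)
    rw [gaussianPDF, ← ENNReal.ofReal_mul (by positivity)] at h1
    have h2 := ENNReal.toReal_le_of_le_ofReal
      (mul_nonneg (by positivity) (gaussianPDFReal_nonneg 0 1 x)) h1
    push_cast at h2
    calc (q x).toReal ≤ C * (⌊x⌋₊ + 1 : ℝ) ^ d * gaussianPDFReal 0 1 x := h2
      _ ≤ C * (2 * x) ^ d * (Real.exp (3 / 2) * x * (gaussianReal 0 1).real (Set.Ioi x)) := by
          have hφ := gaussianPDFReal_nonneg 0 1 x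
          gcongr
          · linarith
          · exact gaussianPDFReal_le_mul_Ioi h1x.le
      _ = _ := by rw [mul_pow]; ring
  refine ⟨fun x => if max b₀ 1 < x then min (q x).toReal (C * 2 ^ d * Real.exp (3 / 2) *
    x ^ (d + 1) * (gaussianReal 0 1).real (Set.Ioi x)) else (q x).toReal, ?_, fun x hx => ?_⟩
  · conv_lhs => rw [← hμ]
    refine withDensity_congr_ae ?_
    filter_upwards [hqbound, Measure.rnDeriv_lt_top μ volume] with x hx hfin
    split_ifs with hbx
    · rw [min_eq_left (hx hbx), ENNReal.ofReal_toReal hfin.ne]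
    · rw [ENNReal.ofReal_toReal hfin.ne]
  · simp only [hx, if_true]
    exact min_le_right _ _

/-- Lemma `LemOvershoot`.  Under Conditions B1–B2 the law of
`sup_{t∈T} f(t)` is absolutely continuous with respect to Lebesgue measure, with a density
`p_{f*}` satisfying `p_{f*}(x) ≤ c_{f*} x^{d+1} P(f(0) > x)` for all `x > b₀`, for some
constants `c_{f*}` and `b₀`. -/
theorem density_bound_for_supremum
    {Ω : Type} [MeasureSpace Ω] [IsProbabilityMeasure (ℙ : Measure Ω)]
    {d : ℕ} (hd : 0 < d)
    -- Condition B2: `T` is a compact convex `d`-dimensional set with nonempty interior,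
    -- containing `0`, whose boundary is a `(d−1)`-dimensional manifold without boundary,
    -- and which has non-degenerate volume near every point
    (T : Set (Fin d → ℝ)) (hTcompact : IsCompact T) (hTconv : Convex ℝ T)
    (hTint : (interior T).Nonempty) (h0T : (0 : Fin d → ℝ) ∈ T)
    (hTbdry : Nonempty (frontier T ≃ₜ Metric.sphere (0 : EuclideanSpace ℝ (Fin d)) 1))
    (κ₀ : ℝ) (hκ₀ : 0 < κ₀)
    (hB2 : ∀ t ∈ T, ∀ ε : ℝ, 0 < ε → ε < 1 →
      κ₀ * ε ^ d ≤ (volume ({s | nrm (s - t) ≤ ε} ∩ T)).toReal)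
    -- Condition B1: `f` is a centered, unit-variance, homogeneous Gaussian field,
    -- almost surely twice continuously differentiable
    (f : (Fin d → ℝ) → Ω → ℝ) (hfmeas : ∀ t, Measurable (f t))
    (hGauss : ∀ (n : ℕ) (t : Fin n → (Fin d → ℝ)) (c : Fin n → ℝ),
      ∃ v : NNReal,
        Measure.map (fun ω => ∑ i, c i * f (t i) ω) (ℙ : Measure Ω) = gaussianReal 0 v)
    (hvar : (∫ ω, (f 0 ω) ^ 2) = 1)
    (hstat : ∀ (n : ℕ) (t : Fin n → (Fin d → ℝ)) (h : Fin d → ℝ),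
      Measure.map (fun ω (i : Fin n) => f (t i + h) ω) (ℙ : Measure Ω) =
        Measure.map (fun ω (i : Fin n) => f (t i) ω) (ℙ : Measure Ω))
    (hsmooth : ∀ᵐ ω ∂(ℙ : Measure Ω), ContDiff ℝ 2 (fun t => f t ω))
    -- nondegeneracy: the global maximum over `T` is a.s. attained at a unique point
    (huniq : ∀ᵐ ω ∂(ℙ : Measure Ω), ∃! t, t ∈ T ∧ ∀ s ∈ T, f s ω ≤ f t ω)
    :
    ∃ p : ℝ → ℝ,
      Measure.map (fun ω => sSup ((fun t => f t ω) '' T)) (ℙ : Measure Ω) =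
        volume.withDensity (fun x => ENNReal.ofReal (p x)) ∧
      ∃ cf b₀ : ℝ, ∀ x : ℝ, b₀ < x →
        p x ≤ cf * x ^ (d + 1) * (ℙ {ω | f 0 ω > x}).toReal := by
  have hG := isGaussianProcess_of_forall_sum hfmeas hGauss
  have hlaw := map_eq_standard_gaussian hfmeas hGauss hvar hstat
  have hcont : ∀ᵐ ω ∂(ℙ : Measure Ω), Continuous fun t => f t ω := by
    filter_upwards [hsmooth] with ω hω using hω.continuous
  have hdiff : ∀ᵐ ω ∂(ℙ : Measure Ω), DifferentiableAt ℝ (fun t => f t ω) 0 := by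
    filter_upwards [hsmooth] with ω hω using (hω.differentiable (by norm_num)) 0
  obtain ⟨σ, h₀, hσ, hh₀, hinc⟩ := exists_variance_cube_increment_le hfmeas hGauss hstat hdiff
  obtain ⟨R, hR⟩ := hTcompact.isBounded.exists_norm_le
  have hTR : ∀ t ∈ T, ∀ i, |t i| ≤ max R 1 := fun t ht i =>
    ((norm_le_pi_norm t i).trans (hR t ht)).trans (le_max_left _ _)
  obtain ⟨C, b₀, hC, htail⟩ := measure_exists_gt_le hd hG hfmeas hlaw hcont hσ hh₀ hinc
    (le_max_right R 1) hTR
  obtain ⟨hsup, hle⟩ := aemeasurable_sSup_and_map_restrict_le hG hfmeas hlaw hcont hTcompact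
    ⟨0, h0T⟩
  have := Measure.isProbabilityMeasure_map hsup
  obtain ⟨p, hp, hpb⟩ := exists_density_le hC fun b hb => hle b (C * b ^ d).toNNReal (htail b hb)
  refine ⟨p, hp, C * 2 ^ d * Real.exp (3 / 2), max b₀ 1, fun x hx => ?_⟩
  have htailx : (ℙ {ω | f 0 ω > x}).toReal = (gaussianReal 0 1).real (Set.Ioi x) := by
    rw [← hlaw 0, map_measureReal_apply (hfmeas 0) measurableSet_Ioi]
    rfl
  rw [htailx]
  exact hpb x hx
end
end

section
/- Assume Conditions A1–A4 with Hölder exponent β, and fix v > 0; set ρ = 2d/β + dv + 1, w(b) = P(max_{t∈T} f(t) > b), and, for i.i.d. uniform points U₁,…,U_M on T independent of f, w_M(γ) = P(max_{1≤i≤M} f(U_i) > γ). Then there exist constants λ, c, b₀ > 0 and ε₀ > 0 such that for all ε ∈ (0, ε₀] and all b ≥ b₀, choosing a = ε/(4λ b^ρ) and M = ⌈ c ε^{−1} (b/a)^{(4+4v)d/β} ⌉, one has |w(b) − w_M(γ_{a,b})| ≤ ε · w(b). -/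
open MeasureTheory ProbabilityTheory Filter
open scoped Classical

noncomputable section

lemma gaussianPDFReal_le_exp_mul (m : ℝ) (v : NNReal) {b u w : ℝ} (hb : 1 ≤ b) (hub : u ≤ b)
    (huw : u ≤ w) (hwu : w ≤ u + 3 / b) :
    gaussianPDFReal m v u ≤ Real.exp (3 * (5 + 2 * |m|) / (2 * v)) * gaussianPDFReal m v w := by
  have hb0 : 0 < b := by linarith
  rcases eq_or_ne v 0 with rfl | hv
  · simp
  have hv0 : (0 : ℝ) < v := by positivity
  have h3 : 3 / b ≤ 3 := by rw [div_le_iff₀ hb0]; linarith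
  have key : (w - u) * (w + u - 2 * m) ≤ 3 * (5 + 2 * |m|) := by
    have hm := neg_abs_le m
    have h1 : w + u - 2 * m ≤ (5 + 2 * |m|) * b := by nlinarith [abs_nonneg m]
    have h2 : 0 ≤ (5 + 2 * |m|) * b := by positivity
    calc (w - u) * (w + u - 2 * m) ≤ (w - u) * ((5 + 2 * |m|) * b) :=
          mul_le_mul_of_nonneg_left h1 (by linarith)
      _ ≤ (3 / b) * ((5 + 2 * |m|) * b) := mul_le_mul_of_nonneg_right (by linarith) h2
      _ = 3 * (5 + 2 * |m|) := by field_simp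
  have hexp : Real.exp (-(u - m) ^ 2 / (2 * v)) ≤
      Real.exp (3 * (5 + 2 * |m|) / (2 * v)) * Real.exp (-(w - m) ^ 2 / (2 * v)) := by
    rw [← Real.exp_add, Real.exp_le_exp, ← add_div]
    gcongr
    nlinarith [key]
  simp only [gaussianPDFReal]
  calc _ ≤ (√(2 * Real.pi * v))⁻¹ *
        (Real.exp (3 * (5 + 2 * |m|) / (2 * v)) * Real.exp (-(w - m) ^ 2 / (2 * v))) := by gcongr
    _ = _ := by ring

/-- Widening an upper half-line that starts below `b` by at most `2 / b` increases its Gaussian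
mass by at most a bounded factor. -/
lemma exists_gaussianReal_diff_le (m : ℝ) {v : NNReal} (hv : v ≠ 0) :
    ∃ K : ℝ, 0 < K ∧ ∀ b h : ℝ, 1 ≤ b → 0 ≤ h → h ≤ 1 / b → ∀ A : Set ℝ, IsUpperSet A →
      Set.Ioi b ⊆ A → gaussianReal m v ({x | x + 2 * h ∈ A} \ A) ≤
        ENNReal.ofReal (K * h * b) * gaussianReal m v A := by
  set E : ℝ := Real.exp (3 * (5 + 2 * |m|) / (2 * v)) with hE
  have hE0 : 0 < E := Real.exp_pos _
  refine ⟨2 * E, by positivity, fun b h hb hh hhb A hA hbA ↦ ?_⟩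
  have hb0 : 0 < b := by linarith
  have hAm : MeasurableSet A := hA.ordConnected.measurableSet
  have hpdf : ∀ u ∈ {x | x + 2 * h ∈ A} \ A,
      gaussianPDF m v u ≤ ENNReal.ofReal (E * b) * gaussianReal m v A := by
    rintro u ⟨hu1, hu2⟩
    have hub : u ≤ b := by
      by_contra! hcon
      exact hu2 (hbA hcon)
    have hint : ∫⁻ w in Set.Icc (u + 2 * h) (u + 2 * h + 1 / b), gaussianPDF m v u ≤
        ∫⁻ w in Set.Icc (u + 2 * h) (u + 2 * h + 1 / b),
          ENNReal.ofReal E * gaussianPDF m v w := by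
      refine setLIntegral_mono (by fun_prop) fun w hw ↦ ?_
      rw [gaussianPDF, gaussianPDF, ← ENNReal.ofReal_mul hE0.le]
      refine ENNReal.ofReal_le_ofReal (gaussianPDFReal_le_exp_mul m v hb hub ?_ ?_)
      · linarith [hw.1]
      · have := hw.2
        have : 3 / b = 1 / b + 2 * (1 / b) := by ring
        linarith
    rw [setLIntegral_const, Real.volume_Icc, lintegral_const_mul _ (by fun_prop),
      ← gaussianReal_apply m hv] at hint
    have hsub : Set.Icc (u + 2 * h) (u + 2 * h + 1 / b) ⊆ A := fun w hw ↦ hA hw.1 hu1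
    have h1 : gaussianPDF m v u * ENNReal.ofReal (1 / b) ≤
        ENNReal.ofReal E * gaussianReal m v A := by
      refine le_trans (le_of_eq ?_) (hint.trans (by gcongr))
      congr 2; ring
    calc gaussianPDF m v u = gaussianPDF m v u * ENNReal.ofReal (1 / b) * ENNReal.ofReal b := by
          rw [mul_assoc, ← ENNReal.ofReal_mul (by positivity)]
          simp [hb0.ne']
      _ ≤ ENNReal.ofReal E * gaussianReal m v A * ENNReal.ofReal b := by gcongr
      _ = _ := by rw [ENNReal.ofReal_mul hE0.le]; ring
  have hvol : volume ({x | x + 2 * h ∈ A} \ A) ≤ ENNReal.ofReal (2 * h) := by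
    refine (Real.volume_le_diam _).trans (Metric.ediam_le fun x hx y hy ↦ ?_)
    rw [edist_dist]
    refine ENNReal.ofReal_le_ofReal ?_
    have h1 : y ≤ x + 2 * h := by
      by_contra! hcon
      exact hy.2 (hA hcon.le hx.1)
    have h2 : x ≤ y + 2 * h := by
      by_contra! hcon
      exact hx.2 (hA hcon.le hy.1)
    rw [Real.dist_eq, abs_le]
    constructor <;> linarith
  have hms : MeasurableSet ({x | x + 2 * h ∈ A} \ A) :=
    (hAm.preimage (by fun_prop : Measurable fun x : ℝ ↦ x + 2 * h)).diff hAm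
  calc gaussianReal m v ({x | x + 2 * h ∈ A} \ A)
      = ∫⁻ u in {x | x + 2 * h ∈ A} \ A, gaussianPDF m v u := gaussianReal_apply m hv _
    _ ≤ ∫⁻ u in {x | x + 2 * h ∈ A} \ A, ENNReal.ofReal (E * b) * gaussianReal m v A :=
        setLIntegral_mono' hms hpdf
    _ = ENNReal.ofReal (E * b) * gaussianReal m v A * volume ({x | x + 2 * h ∈ A} \ A) := by
        rw [setLIntegral_const]
    _ ≤ ENNReal.ofReal (E * b) * gaussianReal m v A * ENNReal.ofReal (2 * h) := by gcongr
    _ = _ := by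
        rw [mul_right_comm, ← ENNReal.ofReal_mul (by positivity)]
        congr 2; ring

/-- A Gaussian upper tail decays no faster than a Gaussian function. -/
lemma exists_exp_le_gaussianReal_Ioi (m : ℝ) {v : NNReal} (hv : v ≠ 0) :
    ∃ c C : ℝ, 0 < c ∧ 0 < C ∧ ∀ b : ℝ, 1 ≤ b →
      c * Real.exp (-(C * b ^ 2)) ≤ (gaussianReal m v).real (Set.Ioi b) := by
  have hv0 : (0 : ℝ) < v := by positivity
  refine ⟨(√(2 * Real.pi * v))⁻¹, (2 + |m|) ^ 2 / (2 * v), by positivity, by positivity,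
    fun b hb ↦ ?_⟩
  set p : ℝ := (√(2 * Real.pi * v))⁻¹ * Real.exp (-((2 + |m|) ^ 2 / (2 * v) * b ^ 2)) with hp
  have hp0 : 0 ≤ p := by positivity
  have hle : ENNReal.ofReal p ≤ gaussianReal m v (Set.Ioi b) := by
    calc ENNReal.ofReal p = ∫⁻ w in Set.Ioc b (b + 1), ENNReal.ofReal p := by
          rw [setLIntegral_const, Real.volume_Ioc]; simp
      _ ≤ ∫⁻ w in Set.Ioc b (b + 1), gaussianPDF m v w := by
          refine setLIntegral_mono (by fun_prop) fun w hw ↦ ENNReal.ofReal_le_ofReal ?_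
          rw [hp, gaussianPDFReal]
          gcongr
          rw [neg_div, neg_le_neg_iff, div_mul_eq_mul_div]
          gcongr
          rw [← mul_pow]
          refine sq_le_sq' ?_ ?_
          · nlinarith [hw.1, hw.2, abs_nonneg m, le_abs_self m]
          · nlinarith [hw.1, hw.2, abs_nonneg m, neg_abs_le m]
      _ = gaussianReal m v (Set.Ioc b (b + 1)) := (gaussianReal_apply m hv _).symm
      _ ≤ _ := measure_mono fun x hx ↦ hx.1
  rw [Measure.real]
  exact (ENNReal.ofReal_le_iff_le_toReal (measure_ne_top _ _)).1 hle

/-- Chernoff bound for a Gaussian variable whose mean is at most `y / 2`. -/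
lemma gaussianReal_Ici_le {m V y : ℝ} {v : NNReal} (hV : 0 < V) (hvV : (v : ℝ) ≤ V)
    (hy : 0 ≤ y) (hm : m ≤ y / 2) :
    (gaussianReal m v).real (Set.Ici y) ≤ Real.exp (-(y ^ 2 / (8 * V))) := by
  have h := measure_ge_le_exp_mul_mgf (μ := gaussianReal m v) (X := id) (t := y / 2 / V) y
    (by positivity) (integrable_exp_mul_gaussianReal _)
  rw [mgf_id_gaussianReal] at h
  refine (le_of_eq (by rfl)).trans (h.trans ?_)
  dsimp only
  rw [← Real.exp_add, Real.exp_le_exp]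
  have h1 : m * (y / 2 / V) ≤ y / 2 * (y / 2 / V) := by gcongr
  have h2 : (v : ℝ) * (y / 2 / V) ^ 2 / 2 ≤ V * (y / 2 / V) ^ 2 / 2 := by gcongr
  calc _ ≤ -(y / 2 / V) * y + (y / 2 * (y / 2 / V) + V * (y / 2 / V) ^ 2 / 2) := by linarith
    _ = _ := by field_simp; ring

/-- Residuals of the regression of a Gaussian process on one of its values are independent of
that value. -/
lemma ProbabilityTheory.IsGaussianProcess.indepFun_residual {Ω S : Type*} {mΩ : MeasurableSpace Ω}
    {P : Measure Ω} {X : S → Ω → ℝ} (hX : IsGaussianProcess X P) (mX : ∀ t, Measurable (X t))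
    (t₀ : S) (hv : Var[X t₀; P] ≠ 0) (D : Set S) :
    IndepFun (X t₀)
      (fun ω (t : D) ↦ X t ω - cov[X t, X t₀; P] / Var[X t₀; P] * X t₀ ω) P := by
  have : IsProbabilityMeasure P := hX.isProbabilityMeasure
  have hL2 (t : S) : MemLp (X t) 2 P := (hX.hasGaussianLaw_eval t).memLp_two
  set Y : D → Ω → ℝ := fun t ω ↦ X t ω - cov[X t, X t₀; P] / Var[X t₀; P] * X t₀ ω with hY
  have hjoint : IsGaussianProcess (Sum.elim (fun _ : Unit ↦ X t₀) Y) P := by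
    refine hX.of_isGaussianProcess fun s ↦ ?_
    rcases s with s | t
    · exact ⟨{t₀}, .proj ⟨t₀, by simp⟩, fun ω ↦ rfl⟩
    · refine ⟨{t.1, t₀}, .proj ⟨t.1, by simp⟩ -
        (cov[X t, X t₀; P] / Var[X t₀; P]) • .proj ⟨t₀, by simp⟩, fun ω ↦ ?_⟩
      simp [hY]
  have hind := hjoint.indepFun_of_covariance_eq_zero (fun _ ↦ (mX t₀).aemeasurable)
    (fun t ↦ by fun_prop) (fun _ t ↦ by
      have h1 : Y t = X t - (fun ω ↦ cov[X t, X t₀; P] / Var[X t₀; P] * X t₀ ω) := rfl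
      rw [h1, covariance_sub_right (hL2 _) (hL2 _) ((hL2 _).const_mul _),
        covariance_const_mul_right, covariance_self (mX t₀).aemeasurable,
        div_mul_cancel₀ _ hv, covariance_comm, sub_self])
  exact hind.comp (φ := fun x : Unit → ℝ ↦ x ()) (measurable_pi_apply _) measurable_id

/-- Anti-concentration for the supremum of a Gaussian process over a set of indices well
correlated with a given one. -/
lemma ProbabilityTheory.IsGaussianProcess.exists_measure_diff_le_of_cov {Ω S : Type*}
    {mΩ : MeasurableSpace Ω}
    {P : Measure Ω} {X : S → Ω → ℝ} (hX : IsGaussianProcess X P) (mX : ∀ t, Measurable (X t))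
    (t₀ : S) (hv : 0 < Var[X t₀; P]) :
    ∃ K : ℝ, 0 < K ∧ ∀ D : Set S, D.Countable → t₀ ∈ D →
      (∀ t ∈ D, Var[X t₀; P] / 2 ≤ cov[X t, X t₀; P]) →
      ∀ b h : ℝ, 1 ≤ b → 0 ≤ h → h ≤ 1 / b →
      P ({ω | ∃ t ∈ D, b - h < X t ω} \ {ω | ∃ t ∈ D, b < X t ω}) ≤
        ENNReal.ofReal (K * h * b) * P {ω | ∃ t ∈ D, b < X t ω} := by
  have : IsProbabilityMeasure P := hX.isProbabilityMeasure
  have hlaw := (hX.hasGaussianLaw_eval t₀).map_eq_gaussianReal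
  have hv' : (Var[X t₀; P]).toNNReal ≠ 0 := by simpa using hv
  obtain ⟨K, hK, hKb⟩ := exists_gaussianReal_diff_le (∫ ω, X t₀ ω ∂P) hv'
  refine ⟨K, hK, fun D hD ht₀ hcov b h hb hh hhb ↦ ?_⟩
  have hDc : Countable D := hD.to_subtype
  set N := gaussianReal (∫ ω, X t₀ ω ∂P) (Var[X t₀; P]).toNNReal with hN
  set c : S → ℝ := fun t ↦ cov[X t, X t₀; P] / Var[X t₀; P] with hc
  have hc1 (t : S) (ht : t ∈ D) : 1 / 2 ≤ c t := by
    rw [hc, le_div_iff₀ hv]; linarith [hcov t ht]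
  set Y : Ω → D → ℝ := fun ω t ↦ X t ω - c t * X t₀ ω with hY
  have mY : Measurable Y := by
    refine measurable_pi_iff.2 fun t ↦ ?_
    have := mX t
    have := mX t₀
    fun_prop
  have hind : IndepFun (X t₀) Y P := hX.indepFun_residual mX t₀ hv.ne' D
  have hmap : P.map (fun ω ↦ (X t₀ ω, Y ω)) = N.prod (P.map Y) := by
    rw [(indepFun_iff_map_prod_eq_prod_map_map (mX t₀).aemeasurable mY.aemeasurable).1 hind, hlaw]
  set B : ℝ → Set (ℝ × (D → ℝ)) := fun y ↦ {p | y < p.1 ∨ ∃ t : D, y < c t * p.1 + p.2 t} with hB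
  have mB (y : ℝ) : MeasurableSet (B y) := by
    have : B y = {p | y < p.1} ∪ ⋃ t : D, {p | y < c t * p.1 + p.2 t} := by
      ext p; simp [hB]
    rw [this]
    refine (measurableSet_lt (by fun_prop) (by fun_prop)).union (.iUnion fun t ↦ ?_)
    exact measurableSet_lt (by fun_prop) (by fun_prop)
  have hpre (y : ℝ) : (fun ω ↦ (X t₀ ω, Y ω)) ⁻¹' (B y) = {ω | ∃ t ∈ D, y < X t ω} := by
    ext ω
    simp only [hB, hY, Set.mem_preimage, Set.mem_ofPred_eq, add_sub_cancel, Subtype.exists,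
      exists_prop]
    exact ⟨fun h ↦ h.elim (fun h ↦ ⟨t₀, ht₀, h⟩) id, Or.inr⟩
  have mpair : Measurable (fun ω ↦ (X t₀ ω, Y ω)) := (mX t₀).prodMk mY
  have : IsProbabilityMeasure (P.map Y) := Measure.isProbabilityMeasure_map mY.aemeasurable
  rw [← hpre, ← hpre, ← Set.preimage_sdiff, ← Measure.map_apply mpair ((mB _).diff (mB _)),
    ← Measure.map_apply mpair (mB _), hmap, Measure.prod_apply_symm ((mB _).diff (mB _)),
    Measure.prod_apply_symm (mB _), ← lintegral_const_mul _ (measurable_measure_prodMk_right (mB _))]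
  refine lintegral_mono fun g ↦ ?_
  have hsec := hKb b h hb hh hhb ((fun x ↦ (x, g)) ⁻¹' B b) ?_ ?_
  · refine le_trans (measure_mono ?_) hsec
    rintro x ⟨hx1, hx2⟩
    refine ⟨?_, hx2⟩
    simp only [hB, Set.mem_preimage, Set.mem_ofPred_eq] at hx1 ⊢
    rcases hx1 with hx1 | ⟨t, ht⟩
    · left; linarith
    · right
      refine ⟨t, ?_⟩
      nlinarith [hc1 t t.2]
  · intro x y hxy hx
    simp only [hB, Set.mem_preimage, Set.mem_ofPred_eq] at hx ⊢
    rcases hx with hx | ⟨t, ht⟩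
    · left; linarith
    · right
      refine ⟨t, ?_⟩
      nlinarith [hc1 t t.2]
  · intro x hx
    exact Or.inl hx

/-- Membership of a strict superlevel set can be tested on a dense set of indices. -/
lemma exists_lt_iff_of_dense {S : Type*} [TopologicalSpace S] {D U : Set S} (hDU : D ⊆ U)
    (hUD : U ⊆ closure D) {x : S → ℝ} (hx : Continuous x) (y : ℝ) :
    (∃ t ∈ D, y < x t) ↔ ∃ t ∈ U, y < x t := by
  refine ⟨fun ⟨t, ht, h⟩ ↦ ⟨t, hDU ht, h⟩, fun ⟨t, ht, h⟩ ↦ ?_⟩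
  obtain ⟨s, hs, hsD⟩ := mem_closure_iff.1 (hUD ht) _ (isOpen_lt continuous_const hx) h
  exact ⟨s, hsD, hs⟩

lemma measurableSet_exists_lt {Ω S : Type*} [TopologicalSpace S] [SecondCountableTopology S]
    {mΩ : MeasurableSpace Ω} {X : S → Ω → ℝ} (mX : ∀ t, Measurable (X t))
    (cX : ∀ ω, Continuous (X · ω)) (y : ℝ) : MeasurableSet {ω | ∃ t, y < X t ω} := by
  obtain ⟨D, hD, hdense⟩ := TopologicalSpace.exists_countable_dense S
  have : {ω | ∃ t, y < X t ω} = ⋃ t ∈ D, {ω | y < X t ω} := by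
    ext ω
    have := exists_lt_iff_of_dense (Set.subset_univ D) (by simp [hdense.closure_eq]) (cX ω) y
    simpa using this.symm
  rw [this]
  exact .biUnion hD fun t _ ↦ measurableSet_lt measurable_const (mX t)

/-- Anti-concentration for the supremum of a continuous nondegenerate Gaussian process over a
compact index space: a tail version on relative scale. -/
lemma ProbabilityTheory.IsGaussianProcess.exists_measureReal_exists_lt_le {Ω S : Type*}
    [TopologicalSpace S] [TopologicalSpace.PseudoMetrizableSpace S] [SecondCountableTopology S]
    [CompactSpace S]
    {mΩ : MeasurableSpace Ω}
    {P : Measure Ω} {X : S → Ω → ℝ} (hX : IsGaussianProcess X P) (mX : ∀ t, Measurable (X t))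
    (cX : ∀ ω, Continuous (X · ω)) (hv : ∀ t, 0 < Var[X t; P])
    (hcov : ∀ t₀, ContinuousAt (fun t ↦ cov[X t, X t₀; P]) t₀) :
    ∃ K : ℝ, 0 < K ∧ ∀ b h : ℝ, 1 ≤ b → 0 ≤ h → h ≤ 1 / b →
      P.real {ω | ∃ t, b - h < X t ω} ≤ (1 + K * h * b) * P.real {ω | ∃ t, b < X t ω} := by
  have : IsProbabilityMeasure P := hX.isProbabilityMeasure
  choose K hK hKb using fun t₀ ↦ hX.exists_measure_diff_le_of_cov mX t₀ (hv t₀)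
  set U : S → Set S := fun t₀ ↦ {t | Var[X t₀; P] / 2 ≤ cov[X t, X t₀; P]} with hU
  have hUn (t₀ : S) : U t₀ ∈ nhds t₀ := by
    have h1 : Var[X t₀; P] / 2 < cov[X t₀, X t₀; P] := by
      rw [covariance_self (mX t₀).aemeasurable]; linarith [hv t₀]
    filter_upwards [(hcov t₀).eventually (lt_mem_nhds h1)] with t ht using ht.le
  obtain ⟨I, hI⟩ := CompactSpace.elim_nhds_subcover U hUn
  refine ⟨∑ i ∈ I, K i + 1, by have := Finset.sum_nonneg fun i (_ : i ∈ I) ↦ (hK i).le; linarith,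
    fun b h hb hh hhb ↦ ?_⟩
  have hloc (i : S) : P ({ω | ∃ t ∈ U i, b - h < X t ω} \ {ω | ∃ t ∈ U i, b < X t ω}) ≤
      ENNReal.ofReal (K i * h * b) * P {ω | ∃ t ∈ U i, b < X t ω} := by
    obtain ⟨D, hDU, hD, hcl⟩ := TopologicalSpace.IsSeparable.exists_countable_dense_subset
      (TopologicalSpace.IsSeparable.of_separableSpace (U i))
    have h1 : insert i D ⊆ U i := Set.insert_subset (mem_of_mem_nhds (hUn i)) hDU
    have h2 : U i ⊆ closure (insert i D) := hcl.trans (closure_mono (Set.subset_insert _ _))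
    have := hKb i (insert i D) (hD.insert i) (Set.mem_insert _ _) (fun t ht ↦ h1 ht) b h hb hh hhb
    have h3 (y : ℝ) : {ω | ∃ t ∈ insert i D, y < X t ω} = {ω | ∃ t ∈ U i, y < X t ω} := by
      ext ω
      exact exists_lt_iff_of_dense h1 h2 (cX ω) y
    rwa [h3, h3] at this
  have hloc' (i : S) :
      P.real ({ω | ∃ t ∈ U i, b - h < X t ω} \ {ω | ∃ t ∈ U i, b < X t ω}) ≤
        K i * h * b * P.real {ω | ∃ t, b < X t ω} := by
    have hK0 : 0 ≤ K i * h * b := by have := (hK i).le; positivity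
    refine (ENNReal.toReal_mono (by finiteness) (hloc i)).trans ?_
    rw [ENNReal.toReal_mul, ENNReal.toReal_ofReal hK0]
    refine mul_le_mul_of_nonneg_left ?_ hK0
    exact measureReal_mono fun ω ⟨t, _, ht⟩ ↦ ⟨t, ht⟩
  have hsub : {ω | ∃ t, b - h < X t ω} ⊆ {ω | ∃ t, b < X t ω} ∪
      ⋃ i ∈ I, ({ω | ∃ t ∈ U i, b - h < X t ω} \ {ω | ∃ t ∈ U i, b < X t ω}) := by
    rintro ω ⟨t, ht⟩
    by_cases hω : ∃ t, b < X t ω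
    · exact Or.inl hω
    · obtain ⟨i, hi, hit⟩ := Set.mem_iUnion₂.1 (hI.symm ▸ Set.mem_univ t : t ∈ ⋃ x ∈ I, U x)
      refine Or.inr (Set.mem_iUnion₂.2 ⟨i, hi, ⟨t, hit, ht⟩, ?_⟩)
      rintro ⟨s, _, hs⟩
      exact hω ⟨s, hs⟩
  calc P.real {ω | ∃ t, b - h < X t ω} ≤ _ := measureReal_mono hsub
    _ ≤ _ := measureReal_union_le _ _
    _ ≤ P.real {ω | ∃ t, b < X t ω} + ∑ i ∈ I, K i * h * b * P.real {ω | ∃ t, b < X t ω} := by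
        gcongr
        exact (measureReal_biUnion_finset_le _ _).trans (Finset.sum_le_sum fun i _ ↦ hloc' i)
    _ ≤ _ := by
        rw [← Finset.sum_mul, ← Finset.sum_mul, ← Finset.sum_mul]
        have : 0 ≤ h * b * P.real {ω | ∃ t, b < X t ω} := by positivity
        nlinarith

lemma ProbabilityTheory.IsGaussianProcess.measureReal_le_sub_le {Ω S : Type*}
    {mΩ : MeasurableSpace Ω}
    {P : Measure Ω} {X : S → Ω → ℝ} (hX : IsGaussianProcess X P) (mX : ∀ t, Measurable (X t))
    {s t : S} {V y : ℝ} (hV : 0 < V) (hvar : Var[X t - X s; P] ≤ V) (hy : 0 ≤ y)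
    (hm : P[X t] - P[X s] ≤ y / 2) :
    P.real {ω | y ≤ X t ω - X s ω} ≤ Real.exp (-(y ^ 2 / (8 * V))) := by
  have hlaw := (hX.hasGaussianLaw_sub (s := t) (t := s)).map_eq_gaussianReal
  have hint (u : S) : Integrable (X u) P := (hX.hasGaussianLaw_eval u).integrable
  have hmean : P[X t - X s] = P[X t] - P[X s] := integral_sub (hint t) (hint s)
  have hpre : {ω | y ≤ X t ω - X s ω} = (X t - X s) ⁻¹' (Set.Ici y) := rfl
  rw [hpre, ← map_measureReal_apply ((mX t).sub (mX s)) measurableSet_Ici, hlaw]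
  exact gaussianReal_Ici_le hV (by simp [hvar]) hy (by rw [hmean]; exact hm)

/-- Markov's inequality for the mass of a random section. -/
lemma mul_measure_le_measure_section_le {Ω E : Type*} [MeasurableSpace Ω] [MeasurableSpace E]
    (P : Measure Ω) [IsProbabilityMeasure P] (ρ : Measure E) [IsProbabilityMeasure ρ]
    {Q : Set (Ω × E)} (hQ : MeasurableSet Q) {e : ENNReal} (he : ∀ p, P {ω | (ω, p) ∈ Q} ≤ e)
    (m : ENNReal) : m * P {ω | m ≤ ρ {p | (ω, p) ∈ Q}} ≤ e := by
  calc m * P {ω | m ≤ ρ {p | (ω, p) ∈ Q}} ≤ ∫⁻ ω, ρ {p | (ω, p) ∈ Q} ∂P :=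
        mul_meas_ge_le_lintegral (measurable_measure_prodMk_left hQ) m
    _ = (P.prod ρ) Q := (Measure.prod_apply hQ).symm
    _ = ∫⁻ p, P {ω | (ω, p) ∈ Q} ∂ρ := Measure.prod_apply_symm hQ
    _ ≤ ∫⁻ _, e ∂ρ := lintegral_mono he
    _ = e := by simp

/-- If a continuous function exceeds `b` at `t₀` but exceeds a smaller level only on a small set,
then many pairs of points at some dyadic scale witness a large increment. -/
lemma exists_le_prod_increment {S : Type*} [PseudoMetricSpace S] [MeasurableSpace S]
    [OpensMeasurableSpace S] (ν : Measure S) [IsProbabilityMeasure ν] {x : S → ℝ}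
    (hx : Continuous x) {b : ℝ} {t₀ : S} (hb : b < x t₀) {r γ : ℕ → ℝ}
    (hr : Tendsto r atTop (nhds 0)) (hγ : ∀ k, γ k ≤ b)
    (h0 : ν.real {t | γ 0 < x t} < ν.real (Metric.closedBall t₀ (r 0)) / 2) :
    ∃ k, ν.real (Metric.closedBall t₀ (r k)) / 2 * (ν.real (Metric.closedBall t₀ (r (k + 1))) / 2) ≤
      (ν.prod ν).real {p | dist p.1 p.2 ≤ r k + r (k + 1) ∧ γ (k + 1) - γ k ≤ x p.2 - x p.1} := by
  set good : ℕ → Prop := fun k ↦ ν.real (Metric.closedBall t₀ (r k)) / 2 ≤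
    ν.real (Metric.closedBall t₀ (r k) ∩ {t | γ k < x t}) with hgood
  have hex : ∃ k, good k := by
    obtain ⟨η, hη, hball⟩ := Metric.isOpen_iff.1 (isOpen_lt continuous_const hx) t₀ hb
    obtain ⟨k, hk⟩ := (hr.eventually (gt_mem_nhds hη)).exists
    refine ⟨k, ?_⟩
    have : Metric.closedBall t₀ (r k) ∩ {t | γ k < x t} = Metric.closedBall t₀ (r k) := by
      refine Set.inter_eq_left.2 fun t ht ↦ ?_
      exact (hγ k).trans_lt (hball (Metric.closedBall_subset_ball hk ht))
    simp only [hgood, this]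
    linarith [measureReal_nonneg (μ := ν) (s := Metric.closedBall t₀ (r k))]
  have hbad : ¬ good 0 := by
    simp only [hgood, not_le]
    exact (measureReal_mono Set.inter_subset_right).trans_lt h0
  obtain ⟨n, hn⟩ : ∃ n, Nat.find hex = n + 1 :=
    Nat.exists_eq_succ_of_ne_zero fun h ↦ hbad (h ▸ Nat.find_spec hex)
  have h1 : good (n + 1) := hn ▸ Nat.find_spec hex
  have h2 : ¬ good n := Nat.find_min hex (by omega)
  refine ⟨n, ?_⟩
  have h3 : ν.real (Metric.closedBall t₀ (r n)) / 2 ≤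
      ν.real (Metric.closedBall t₀ (r n) \ {t | γ n < x t}) := by
    have := measureReal_inter_add_sdiff (μ := ν) (s := Metric.closedBall t₀ (r n))
      (isOpen_lt continuous_const hx : IsOpen {t | γ n < x t}).measurableSet
    simp only [hgood, not_le] at h2
    linarith
  calc _ ≤ ν.real (Metric.closedBall t₀ (r n) \ {t | γ n < x t}) *
        ν.real (Metric.closedBall t₀ (r (n + 1)) ∩ {t | γ (n + 1) < x t}) := by gcongr
    _ = (ν.prod ν).real ((Metric.closedBall t₀ (r n) \ {t | γ n < x t}) ×ˢ
        (Metric.closedBall t₀ (r (n + 1)) ∩ {t | γ (n + 1) < x t})) := (measureReal_prod_prod _ _).symm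
    _ ≤ _ := by
        refine measureReal_mono ?_
        rintro ⟨s, t⟩ ⟨⟨hs1, hs2⟩, ht1, ht2⟩
        simp only [Set.mem_ofPred_eq, not_lt, Metric.mem_closedBall] at hs1 hs2 ht1 ht2 ⊢
        refine ⟨(dist_triangle_right s t t₀).trans (by linarith), by linarith⟩

/-- A quadratic exponential absorbs polynomial and geometric factors. -/
lemma exists_rpow_mul_pow_mul_exp_le {c p A w : ℝ} (hc : 0 < c) (hA : 1 ≤ A)
    (hw : 1 < w) :
    ∃ C : ℝ, 0 < C ∧ ∀ L : ℝ, 1 ≤ L → ∀ k : ℕ,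
      L ^ p * A ^ k * Real.exp (-(2 * c * L ^ 2 * w ^ k)) ≤
        C * Real.exp (-(c * L ^ 2)) * (1 / 2) ^ k := by
  obtain ⟨j, hj⟩ := pow_unbounded_of_one_lt (2 * A) hw
  obtain ⟨i, hi⟩ := exists_nat_ge p
  set n := i + j with hn
  refine ⟨n.factorial / c ^ n, by positivity, fun L hL k ↦ ?_⟩
  have hL0 : 0 < L := by linarith
  have hw0 : 0 < w := by linarith
  have hwk : 1 ≤ w ^ k := one_le_pow₀ hw.le
  have hL2 : 1 ≤ L ^ 2 := one_le_pow₀ hL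
  set y := L ^ 2 * w ^ k with hy
  have hy1 : 1 ≤ y := one_le_mul_of_one_le_of_one_le hL2 hwk
  have h1 : L ^ p ≤ y ^ i := by
    calc L ^ p ≤ L ^ (i : ℝ) := Real.rpow_le_rpow_of_exponent_le hL hi
      _ = L ^ i := Real.rpow_natCast _ _
      _ ≤ y ^ i := by gcongr; nlinarith
  have h2 : (2 * A) ^ k ≤ y ^ j := by
    calc (2 * A) ^ k ≤ (w ^ j) ^ k := by gcongr
      _ = (w ^ k) ^ j := by rw [← pow_mul, ← pow_mul, mul_comm]
      _ ≤ y ^ j := by gcongr; nlinarith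
  have h3 : y ^ n ≤ n.factorial / c ^ n * Real.exp (c * y) := by
    have := Real.pow_div_factorial_le_exp (c * y) (by positivity) n
    rw [mul_pow, div_le_iff₀ (by positivity)] at this
    rw [div_mul_eq_mul_div, le_div_iff₀ (by positivity)]
    linarith
  have h4 : Real.exp (c * y) * Real.exp (-(2 * c * L ^ 2 * w ^ k)) ≤ Real.exp (-(c * L ^ 2)) := by
    rw [← Real.exp_add, Real.exp_le_exp]
    have : c * L ^ 2 ≤ c * y := by gcongr; nlinarith
    have : 2 * c * L ^ 2 * w ^ k = 2 * (c * y) := by rw [hy]; ring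
    linarith
  have hAk : A ^ k = (2 * A) ^ k * (1 / 2) ^ k := by rw [← mul_pow]; congr 1; ring
  calc L ^ p * A ^ k * Real.exp (-(2 * c * L ^ 2 * w ^ k))
      = L ^ p * (2 * A) ^ k * Real.exp (-(2 * c * L ^ 2 * w ^ k)) * (1 / 2) ^ k := by
        rw [hAk]; ring
    _ ≤ y ^ i * y ^ j * Real.exp (-(2 * c * L ^ 2 * w ^ k)) * (1 / 2) ^ k := by gcongr
    _ = y ^ n * Real.exp (-(2 * c * L ^ 2 * w ^ k)) * (1 / 2) ^ k := by rw [hn, pow_add]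
    _ ≤ n.factorial / c ^ n * Real.exp (c * y) * Real.exp (-(2 * c * L ^ 2 * w ^ k)) *
        (1 / 2) ^ k := by gcongr
    _ = n.factorial / c ^ n * (Real.exp (c * y) * Real.exp (-(2 * c * L ^ 2 * w ^ k))) *
        (1 / 2) ^ k := by ring
    _ ≤ _ := by gcongr

lemma measureReal_iUnion_le_two_mul {Ω : Type*} [MeasurableSpace Ω] (P : Measure Ω)
    [IsFiniteMeasure P] {B : ℕ → Set Ω} {A : ℝ} (hA : 0 ≤ A)
    (hB : ∀ k, P.real (B k) ≤ A * (1 / 2) ^ k) : P.real (⋃ k, B k) ≤ 2 * A := by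
  have hs : Summable fun k : ℕ ↦ A * (1 / 2 : ℝ) ^ k := summable_geometric_two.mul_left A
  refine ENNReal.toReal_le_of_le_ofReal (by positivity) ?_
  calc P (⋃ k, B k) ≤ ∑' k, P (B k) := measure_iUnion_le _
    _ ≤ ∑' k, ENNReal.ofReal (A * (1 / 2) ^ k) := by
        refine ENNReal.tsum_le_tsum fun k ↦ ?_
        rw [← ofReal_measureReal]
        exact ENNReal.ofReal_le_ofReal (hB k)
    _ = ENNReal.ofReal (∑' k : ℕ, A * (1 / 2) ^ k) :=
        (ENNReal.ofReal_tsum_of_nonneg (fun k ↦ by positivity) hs).symm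
    _ = _ := by rw [tsum_mul_left, tsum_geometric_two, mul_comm]

/-- A continuous Gaussian process with Hölder increments that exceeds `b` somewhere exceeds
`b - 1 / L` on a set of polynomially small mass, up to a probability decaying like a Gaussian
function of `L`. -/
lemma ProbabilityTheory.IsGaussianProcess.exists_measureReal_small_excursion_le {Ω S : Type*}
    [MetricSpace S] [SecondCountableTopology S] [MeasurableSpace S] [BorelSpace S]
    {mΩ : MeasurableSpace Ω}
    {P : Measure Ω} {X : S → Ω → ℝ} (hX : IsGaussianProcess X P) (mX : ∀ t, Measurable (X t))
    (cX : ∀ ω, Continuous (X · ω)) (ν : Measure S) [IsProbabilityMeasure ν]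
    {β κ δ θ ε₁ : ℝ} {D : ℕ} (hβ : 0 < β) (hκ : 0 < κ) (hδ : 0 < δ) (hθ : 0 < θ) (hε₁ : 0 < ε₁)
    (hinc : ∀ s t, dist s t < δ →
      |P[X t] - P[X s]| ≤ κ * dist s t ^ β ∧ Var[X t - X s; P] ≤ κ * dist s t ^ β)
    (hball : ∀ t r, 0 < r → r < ε₁ → θ * r ^ D ≤ ν.real (Metric.closedBall t r)) :
    ∃ c C L₀ : ℝ, 0 < c ∧ 0 < C ∧ ∀ L, L₀ ≤ L → ∀ b,
      P.real {ω | (∃ t, b < X t ω) ∧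
        ν.real {t | b - 1 / L < X t ω} < θ / 2 * L ^ (-(4 * D / β))} ≤
      C * Real.exp (-(c * L ^ 2)) := by
  have : IsProbabilityMeasure P := hX.isProbabilityMeasure
  set q : ℝ := (1 / 2) ^ (β / 4) with hq
  have hq0 : 0 < q := by positivity
  have hq1 : q < 1 := Real.rpow_lt_one (by norm_num) (by norm_num) (by positivity)
  have hq4 : (1 / 2 : ℝ) ^ β = q ^ 4 := by
    rw [hq, ← Real.rpow_natCast, ← Real.rpow_mul (by norm_num)]; congr 1; push_cast; ring
  have h1q : 0 < 1 - q := by linarith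
  set κ₂ : ℝ := κ * 2 ^ β with hκ₂
  have hκ₂0 : 0 < κ₂ := by positivity
  set c : ℝ := (1 - q) ^ 2 / (16 * κ₂) with hc
  have hc0 : 0 < c := by positivity
  set w : ℝ := q⁻¹ ^ 2 with hw
  have hw1 : 1 < w := one_lt_pow₀ ((one_lt_inv₀ hq0).2 hq1) (by norm_num)
  obtain ⟨C₁, hC₁, hpoly⟩ := exists_rpow_mul_pow_mul_exp_le (p := 8 * D / β) (A := 4 ^ D) hc0
    (one_le_pow₀ (by norm_num)) hw1
  have hlim : Tendsto (fun L : ℝ ↦ L ^ (-(4 / β))) atTop (nhds 0) :=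
    tendsto_rpow_neg_atTop (by positivity)
  obtain ⟨L₀, hL₀⟩ := eventually_atTop.1 ((eventually_ge_atTop (1 : ℝ)).and
    ((hlim.eventually (gt_mem_nhds hε₁)).and
      ((hlim.eventually (gt_mem_nhds (half_pos hδ))).and
        (eventually_ge_atTop (2 * κ₂ / (1 - q))))))
  refine ⟨c, 2 * (4 * 2 ^ D / θ ^ 2 * C₁), L₀, hc0, by positivity, fun L hL b ↦ ?_⟩
  obtain ⟨hL1, hLε, hLδ, hLκ⟩ := hL₀ L hL
  rw [div_le_iff₀ h1q] at hLκ
  have hL0 : 0 < L := by linarith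
  set R : ℝ := L ^ (-(4 / β)) with hR
  have hR0 : 0 < R := by positivity
  have hRβ : R ^ β = (L ^ 4)⁻¹ := by
    rw [hR, ← Real.rpow_mul hL0.le, ← Real.rpow_natCast, ← Real.rpow_neg hL0.le]
    congr 1; push_cast; field_simp
  have hRD : R ^ D = L ^ (-(4 * D / β)) := by
    rw [hR, ← Real.rpow_natCast, ← Real.rpow_mul hL0.le]; congr 1; ring
  have hRp : L ^ (8 * D / β) * (R ^ D) ^ 2 = 1 := by
    rw [hRD, ← Real.rpow_natCast, ← Real.rpow_mul hL0.le, ← Real.rpow_add hL0]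
    have : 8 * D / β + -(4 * D / β) * (2 : ℕ) = 0 := by push_cast; ring
    rw [this, Real.rpow_zero]
  set r : ℕ → ℝ := fun k ↦ R * (1 / 2) ^ k with hr
  set γ : ℕ → ℝ := fun k ↦ b - q ^ k / L with hγ
  set V : ℕ → ℝ := fun k ↦ κ₂ * (L ^ 4)⁻¹ * (q ^ 4) ^ k with hV
  have hr0 (k : ℕ) : 0 < r k := by positivity
  have hrR (k : ℕ) : r k ≤ R :=
    mul_le_of_le_one_right hR0.le (pow_le_one₀ (by norm_num) (by norm_num))
  have hV0 (k : ℕ) : 0 < V k := by positivity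
  have hVr (k : ℕ) : κ * (2 * r k) ^ β = V k := by
    rw [hr, hV, Real.mul_rpow (by norm_num) (by positivity), Real.mul_rpow hR0.le (by positivity),
      ← Real.rpow_pow_comm (by norm_num), hRβ, hq4]
    ring
  have hΔ (k : ℕ) : γ (k + 1) - γ k = q ^ k * (1 - q) / L := by rw [hγ]; ring
  have hΔ0 (k : ℕ) : 0 ≤ γ (k + 1) - γ k := by rw [hΔ]; positivity
  have hVΔ (k : ℕ) : V k ≤ (γ (k + 1) - γ k) / 2 := by
    rw [hΔ, hV]
    have h1 : (q ^ 4) ^ k ≤ q ^ k := by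
      rw [← pow_mul]; exact pow_le_pow_of_le_one hq0.le hq1.le (by omega)
    have h2 : κ₂ * (L ^ 4)⁻¹ ≤ (1 - q) / L / 2 := by
      rw [div_div, ← div_eq_mul_inv, div_le_div_iff₀ (by positivity) (by positivity)]
      have : L ^ 2 ≤ L ^ 4 := pow_le_pow_right₀ hL1 (by norm_num)
      calc κ₂ * (L * 2) = (2 * κ₂) * L := by ring
        _ ≤ L * (1 - q) * L := by gcongr
        _ = (1 - q) * L ^ 2 := by ring
        _ ≤ (1 - q) * L ^ 4 := by gcongr
    calc κ₂ * (L ^ 4)⁻¹ * (q ^ 4) ^ k ≤ (1 - q) / L / 2 * q ^ k := by gcongr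
      _ = _ := by ring
  have huX : Measurable (Function.uncurry X) := measurable_uncurry_of_continuous_of_measurable cX mX
  set Q : ℕ → Set (Ω × (S × S)) := fun k ↦ {z | dist z.2.1 z.2.2 ≤ r k + r (k + 1) ∧
    γ (k + 1) - γ k ≤ X z.2.2 z.1 - X z.2.1 z.1} with hQ
  have mQ (k : ℕ) : MeasurableSet (Q k) := by
    have h1 : MeasurableSet {z : Ω × (S × S) | dist z.2.1 z.2.2 ≤ r k + r (k + 1)} :=
      measurableSet_le (by fun_prop) (by fun_prop)
    have h2 : Measurable fun z : Ω × (S × S) ↦ X z.2.2 z.1 - X z.2.1 z.1 :=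
      (huX.comp (by fun_prop : Measurable fun z : Ω × (S × S) ↦ (z.2.2, z.1))).sub
        (huX.comp (by fun_prop : Measurable fun z : Ω × (S × S) ↦ (z.2.1, z.1)))
    exact h1.inter (measurableSet_le measurable_const h2)
  have hrr (k : ℕ) : r k + r (k + 1) ≤ 2 * r k := by
    have : r (k + 1) = r k / 2 := by rw [hr]; ring
    linarith [hr0 k]
  set e : ℕ → ℝ := fun k ↦ Real.exp (-((γ (k + 1) - γ k) ^ 2 / (8 * V k))) with he
  have hsec (k : ℕ) (p : S × S) : P {ω | (ω, p) ∈ Q k} ≤ ENNReal.ofReal (e k) := by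
    by_cases hp : dist p.1 p.2 ≤ r k + r (k + 1)
    · have hd : dist p.1 p.2 ≤ 2 * r k := hp.trans (hrr k)
      obtain ⟨h1, h2⟩ := hinc p.1 p.2 (by linarith [hrR k])
      have h3 : κ * dist p.1 p.2 ^ β ≤ V k := by rw [← hVr]; gcongr
      have := hX.measureReal_le_sub_le mX (hV0 k) (h2.trans h3) (hΔ0 k)
        ((le_abs_self _).trans (h1.trans (h3.trans (hVΔ k))))
      rw [← ofReal_measureReal]
      refine ENNReal.ofReal_le_ofReal ((measureReal_mono ?_).trans this)
      exact fun ω hω ↦ hω.2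
    · have : {ω | (ω, p) ∈ Q k} = ∅ := by
        ext ω; simp [hQ, hp]
      simp [this]
  set m : ℕ → ℝ := fun k ↦ θ * r k ^ D / 2 * (θ * r (k + 1) ^ D / 2) with hm
  have hm0 (k : ℕ) : 0 < m k := by have := hr0 k; have := hr0 (k + 1); positivity
  set B : ℕ → Set Ω := fun k ↦ {ω | ENNReal.ofReal (m k) ≤ (ν.prod ν) {p | (ω, p) ∈ Q k}} with hB
  have hm_inv (k : ℕ) : m k * (4 * 2 ^ D / θ ^ 2 * L ^ (8 * D / β) * (4 ^ D) ^ k) = 1 := by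
    have h1 : ((1 / 2 : ℝ) ^ k) ^ D * ((1 / 2 : ℝ) ^ k) ^ D * (4 ^ D) ^ k = 1 := by
      rw [← pow_mul, ← pow_mul, mul_comm D k, ← mul_pow, ← mul_pow]
      norm_num
    have h2 : (1 / 2 : ℝ) ^ D * 2 ^ D = 1 := by rw [← mul_pow]; norm_num
    calc m k * (4 * 2 ^ D / θ ^ 2 * L ^ (8 * D / β) * (4 ^ D) ^ k)
        = (L ^ (8 * D / β) * (R ^ D) ^ 2) * (((1 / 2 : ℝ) ^ k) ^ D * ((1 / 2 : ℝ) ^ k) ^ D *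
          (4 ^ D) ^ k) * ((1 / 2 : ℝ) ^ D * 2 ^ D) := by
          simp only [hm, hr, mul_pow, pow_succ ((1 : ℝ) / 2) k]
          field_simp
          norm_num
      _ = 1 := by rw [hRp, h1, h2]; norm_num
  have he_eq (k : ℕ) : e k = Real.exp (-(2 * c * L ^ 2 * w ^ k)) := by
    simp only [he, hΔ, hV, hc, hw]
    have hy : 0 < q ^ k := by positivity
    rw [pow_right_comm q 4 k, pow_right_comm q⁻¹ 2 k, inv_pow]
    generalize q ^ k = y at hy
    congr 2
    field_simp
    norm_num
  have hBk (k : ℕ) : P.real (B k) ≤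
      4 * 2 ^ D / θ ^ 2 * C₁ * Real.exp (-(c * L ^ 2)) * (1 / 2) ^ k := by
    have h1 := mul_measure_le_measure_section_le P (ν.prod ν) (mQ k) (hsec k)
      (ENNReal.ofReal (m k))
    have h2 : m k * P.real (B k) ≤ e k := by
      have := ENNReal.toReal_mono (by finiteness) h1
      rwa [ENNReal.toReal_mul, ENNReal.toReal_ofReal (hm0 k).le,
        ENNReal.toReal_ofReal (Real.exp_pos _).le] at this
    calc P.real (B k) = 4 * 2 ^ D / θ ^ 2 * L ^ (8 * D / β) * (4 ^ D) ^ k *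
          (m k * P.real (B k)) := by
          rw [← mul_assoc, mul_comm _ (m k), hm_inv, one_mul]
      _ ≤ 4 * 2 ^ D / θ ^ 2 * L ^ (8 * D / β) * (4 ^ D) ^ k * e k := by gcongr
      _ = 4 * 2 ^ D / θ ^ 2 *
          (L ^ (8 * D / β) * (4 ^ D) ^ k * Real.exp (-(2 * c * L ^ 2 * w ^ k))) := by
          rw [he_eq]; ring
      _ ≤ 4 * 2 ^ D / θ ^ 2 * (C₁ * Real.exp (-(c * L ^ 2)) * (1 / 2) ^ k) := by
          exact mul_le_mul_of_nonneg_left (hpoly L hL1 k) (by positivity)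
      _ = _ := by ring
  have hsub : {ω | (∃ t, b < X t ω) ∧
      ν.real {t | b - 1 / L < X t ω} < θ / 2 * L ^ (-(4 * D / β))} ⊆ ⋃ k, B k := by
    rintro ω ⟨⟨t₀, ht₀⟩, hω⟩
    have hrlim : Tendsto r atTop (nhds 0) := by
      have := (tendsto_pow_atTop_nhds_zero_of_lt_one (r := (1 / 2 : ℝ)) (by norm_num)
        (by norm_num)).const_mul R
      rwa [mul_zero] at this
    have hγb (k : ℕ) : γ k ≤ b := by
      have : 0 ≤ q ^ k / L := by positivity
      simp only [hγ]; linarith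
    obtain ⟨k, hk⟩ := exists_le_prod_increment ν (cX ω) ht₀ hrlim hγb (by
      have h1 := hball t₀ (r 0) (hr0 0) ((hrR 0).trans_lt hLε)
      have h2 : θ * r 0 ^ D = θ * L ^ (-(4 * D / β)) := by rw [← hRD]; simp [hr]
      have h3 : γ 0 = b - 1 / L := by simp [hγ]
      rw [h3]
      linarith)
    refine Set.mem_iUnion.2 ⟨k, ?_⟩
    have h1 : m k ≤ (ν.prod ν).real {p | (ω, p) ∈ Q k} := by
      refine le_trans ?_ hk
      have := hball t₀ (r k) (hr0 k) ((hrR k).trans_lt hLε)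
      have := hball t₀ (r (k + 1)) (hr0 (k + 1)) ((hrR (k + 1)).trans_lt hLε)
      have := hr0 k
      have := hr0 (k + 1)
      simp only [hm]
      gcongr
    simp only [hB, Set.mem_ofPred_eq]
    rw [← ofReal_measureReal]
    exact ENNReal.ofReal_le_ofReal h1
  refine (measureReal_mono hsub).trans ((measureReal_iUnion_le_two_mul P (by positivity) hBk).trans
    (le_of_eq (by ring)))

/-- Probability that `M` independent points all miss a random set, on an event `W`. -/
lemma measureReal_prod_pi_forall_notMem_le {Ω S : Type*} [MeasurableSpace Ω] [MeasurableSpace S]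
    (P : Measure Ω) [IsProbabilityMeasure P] (ν : Measure S) [IsProbabilityMeasure ν]
    {G : Set (Ω × S)} (hG : MeasurableSet G) {W : Set Ω} (hW : MeasurableSet W) (M : ℕ) (p : ℝ) :
    (P.prod (Measure.pi fun _ : Fin M ↦ ν)).real {z | z.1 ∈ W ∧ ∀ i, (z.1, z.2 i) ∉ G} ≤
      P.real {ω | ω ∈ W ∧ ν.real {t | (ω, t) ∈ G} < p} + Real.exp (-(p * M)) * P.real W := by
  set N : Set Ω := {ω | ω ∈ W ∧ ν.real {t | (ω, t) ∈ G} < p} with hN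
  have mG (ω : Ω) : MeasurableSet {t | (ω, t) ∈ G} := measurable_prodMk_left hG
  have mN : MeasurableSet N :=
    hW.inter (measurableSet_lt (measurable_measure_prodMk_left hG).ennreal_toReal measurable_const)
  have mA : MeasurableSet {z : Ω × (Fin M → S) | z.1 ∈ W ∧ ∀ i, (z.1, z.2 i) ∉ G} := by
    have h : {z : Ω × (Fin M → S) | z.1 ∈ W ∧ ∀ i, (z.1, z.2 i) ∉ G} =
        Prod.fst ⁻¹' W ∩ ⋂ i, (fun z : Ω × (Fin M → S) ↦ (z.1, z.2 i)) ⁻¹' Gᶜ := by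
      ext z; simp
    rw [h]
    exact (measurable_fst hW).inter
      (.iInter fun i ↦ (by fun_prop : Measurable fun z : Ω × (Fin M → S) ↦ (z.1, z.2 i)) hG.compl)
  have hsec (ω : Ω) : (Measure.pi fun _ : Fin M ↦ ν)
      (Prod.mk ω ⁻¹' {z : Ω × (Fin M → S) | z.1 ∈ W ∧ ∀ i, (z.1, z.2 i) ∉ G}) ≤
      N.indicator 1 ω + W.indicator (fun _ ↦ ENNReal.ofReal (Real.exp (-(p * M)))) ω := by
    by_cases hωW : ω ∈ W
    · by_cases hωN : ω ∈ N
      · simpa [hωN] using prob_le_one.trans le_self_add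
      have hp : p ≤ ν.real {t | (ω, t) ∈ G} := by
        by_contra! h
        exact hωN ⟨hωW, h⟩
      have hset : Prod.mk ω ⁻¹' {z : Ω × (Fin M → S) | z.1 ∈ W ∧ ∀ i, (z.1, z.2 i) ∉ G} =
          Set.univ.pi fun _ ↦ {t | (ω, t) ∈ G}ᶜ := by
        ext u; simp [hωW, Set.mem_pi]
      rw [hset, Measure.pi_pi, Finset.prod_const, Finset.card_univ, Fintype.card_fin,
        ← ofReal_measureReal, probReal_compl_eq_one_sub (mG ω), ← ENNReal.ofReal_pow
          (sub_nonneg.2 measureReal_le_one)]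
      simp only [Set.indicator_of_mem hωW, Set.indicator_of_notMem hωN, zero_add]
      refine ENNReal.ofReal_le_ofReal ?_
      calc (1 - ν.real {t | (ω, t) ∈ G}) ^ M ≤ Real.exp (-ν.real {t | (ω, t) ∈ G}) ^ M :=
            pow_le_pow_left₀ (sub_nonneg.2 measureReal_le_one) (Real.one_sub_le_exp_neg _) _
        _ = Real.exp (-(ν.real {t | (ω, t) ∈ G} * M)) := by rw [← Real.exp_nat_mul]; ring_nf
        _ ≤ Real.exp (-(p * M)) := by gcongr
    · have : Prod.mk ω ⁻¹' {z : Ω × (Fin M → S) | z.1 ∈ W ∧ ∀ i, (z.1, z.2 i) ∉ G} = ∅ := by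
        ext u; simp [hωW]
      rw [this]; simp
  have hle : (P.prod (Measure.pi fun _ : Fin M ↦ ν)) {z | z.1 ∈ W ∧ ∀ i, (z.1, z.2 i) ∉ G} ≤
      P N + ENNReal.ofReal (Real.exp (-(p * M))) * P W := by
    rw [Measure.prod_apply mA]
    refine (lintegral_mono hsec).trans ?_
    rw [lintegral_add_left (measurable_one.indicator mN), lintegral_indicator_one mN,
      lintegral_indicator_const hW]
  have := ENNReal.toReal_mono (by finiteness) hle
  rwa [ENNReal.toReal_add (by finiteness) (by finiteness), ENNReal.toReal_mul,
    ENNReal.toReal_ofReal (Real.exp_pos _).le] at this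

/-- Relative error of the discretized supremum over random points, for a continuous Gaussian
process on a compact metric space with Hölder increments. -/
lemma ProbabilityTheory.IsGaussianProcess.exists_abs_measureReal_sub_le {Ω S : Type*}
    [MetricSpace S] [CompactSpace S] [MeasurableSpace S] [BorelSpace S] {mΩ : MeasurableSpace Ω}
    {P : Measure Ω} {X : S → Ω → ℝ} (hX : IsGaussianProcess X P) (mX : ∀ t, Measurable (X t))
    (cX : ∀ ω, Continuous (X · ω)) (hvar : ∀ t, 0 < Var[X t; P])
    (hcov : ∀ t₀, ContinuousAt (fun t ↦ cov[X t, X t₀; P]) t₀)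
    (ν : Measure S) [IsProbabilityMeasure ν]
    {β κ δ θ ε₁ : ℝ} {D : ℕ} (hβ : 0 < β) (hκ : 0 < κ) (hδ : 0 < δ) (hθ : 0 < θ) (hε₁ : 0 < ε₁)
    (hinc : ∀ s t, dist s t < δ →
      |P[X t] - P[X s]| ≤ κ * dist s t ^ β ∧ Var[X t - X s; P] ≤ κ * dist s t ^ β)
    (hball : ∀ t r, 0 < r → r < ε₁ → θ * r ^ D ≤ ν.real (Metric.closedBall t r))
    {v : ℝ} (hv : 0 < v) :
    ∃ lam c b₀ : ℝ, 0 < lam ∧ 0 < c ∧ 0 < b₀ ∧ ∀ ε : ℝ, 0 < ε → ε ≤ 1 → ∀ b : ℝ, b₀ ≤ b →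
      ∀ a : ℝ, a = ε / (4 * lam * b ^ (2 * (D : ℝ) / β + (D : ℝ) * v + 1)) →
      ∀ M : ℕ, M = Nat.ceil (c * ε⁻¹ * (b / a) ^ ((4 + 4 * v) * (D : ℝ) / β)) →
        |P.real {ω | ∃ t, b < X t ω} -
          (P.prod (Measure.pi fun _ : Fin M ↦ ν)).real {p | ∃ i, b - a / b < X (p.2 i) p.1}| ≤
          ε * P.real {ω | ∃ t, b < X t ω} := by
  have : IsProbabilityMeasure P := hX.isProbabilityMeasure
  obtain ⟨t₀⟩ : Nonempty S := nonempty_of_isProbabilityMeasure ν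
  obtain ⟨K, hK0, hK⟩ := hX.exists_measureReal_exists_lt_le mX cX hvar hcov
  obtain ⟨c₁, C₁, L₀, hc₁, hC₁, hexc⟩ :=
    hX.exists_measureReal_small_excursion_le mX cX ν hβ hκ hδ hθ hε₁ hinc hball
  obtain ⟨c₃, C₃, hc₃, hC₃, hlow⟩ : ∃ c C : ℝ, 0 < c ∧ 0 < C ∧ ∀ b : ℝ, 1 ≤ b →
      c * Real.exp (-(C * b ^ 2)) ≤ P.real {ω | ∃ t, b < X t ω} := by
    have hg : P.map (X t₀) = gaussianReal (P[X t₀]) (Var[X t₀; P]).toNNReal :=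
      (hX.hasGaussianLaw_eval t₀).map_eq_gaussianReal
    obtain ⟨c, C, hc, hC, h⟩ := exists_exp_le_gaussianReal_Ioi (P[X t₀])
      (v := (Var[X t₀; P]).toNNReal) (by simpa using hvar t₀)
    refine ⟨c, C, hc, hC, fun b hb ↦ (h b hb).trans ?_⟩
    rw [← hg, map_measureReal_apply (mX t₀) measurableSet_Ioi]
    exact measureReal_mono fun ω hω ↦ ⟨t₀, hω⟩
  set K' : ℝ := 2 * C₁ / c₃ with hK'
  have hK'0 : 0 < K' := by positivity
  refine ⟨max 1 K, 4 / θ, max (max 1 L₀) ((C₃ + K') / c₁), by positivity, by positivity,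
    by positivity, fun ε hε hε1 b hb a ha M hM ↦ ?_⟩
  have hb1 : 1 ≤ b := (le_max_left _ _).trans ((le_max_left _ _).trans hb)
  have hbL : L₀ ≤ b := (le_max_right _ _).trans ((le_max_left _ _).trans hb)
  have hbc : C₃ + K' ≤ b * c₁ := (div_le_iff₀ hc₁).1 ((le_max_right _ _).trans hb)
  have hb0 : 0 < b := by linarith
  set lam := max 1 K with hlam
  have hlam1 : 1 ≤ lam := le_max_left _ _
  set y : ℝ := b ^ (2 * (D : ℝ) / β + (D : ℝ) * v + 1) with hy
  have hby : b ≤ y := by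
    have h1 : 0 ≤ 2 * (D : ℝ) / β + (D : ℝ) * v := by positivity
    exact Real.self_le_rpow_of_one_le hb1 (by linarith)
  have hy0 : 0 < y := by positivity
  have ha0 : 0 < a := by rw [ha]; positivity
  have hKa : K * a ≤ ε := by
    rw [ha, mul_div_assoc', div_le_iff₀ (by positivity), mul_comm K]
    gcongr
    calc K ≤ lam := le_max_right _ _
      _ ≤ lam * (4 * y) := le_mul_of_one_le_right (by positivity) (by linarith)
      _ = 4 * lam * y := by ring
  have ha1 : a ≤ 1 := by
    rw [ha, div_le_one (by positivity)]
    have : 1 ≤ lam * y := one_le_mul_of_one_le_of_one_le hlam1 (hb1.trans hby)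
    linarith
  set L : ℝ := b / a with hL
  have hLb : b ^ 2 / ε ≤ L := by
    rw [hL, ha, div_div_eq_mul_div]
    gcongr
    have : y ≤ lam * y := le_mul_of_one_le_left hy0.le hlam1
    rw [sq]
    gcongr
    linarith
  have hLb' : b ^ 2 ≤ L := (le_div_self (by positivity) hε hε1).trans hLb
  have hLb1 : b ≤ L := (le_self_pow₀ hb1 two_ne_zero).trans hLb'
  have hL1 : 1 ≤ L := hb1.trans hLb1
  have hab : a / b = 1 / L := by rw [hL, one_div_div]
  set W : Set Ω := {ω | ∃ t, b < X t ω} with hW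
  set γ : ℝ := b - a / b with hγ
  have hγb : γ ≤ b := by
    have : 0 ≤ a / b := by positivity
    linarith
  set E : Set (Ω × (Fin M → S)) := {p | ∃ i, γ < X (p.2 i) p.1} with hE
  have mW : MeasurableSet W := measurableSet_exists_lt mX cX b
  have hw : c₃ * Real.exp (-(C₃ * b ^ 2)) ≤ P.real W := hlow b hb1
  have hup : (P.prod (Measure.pi fun _ : Fin M ↦ ν)).real E ≤ (1 + ε) * P.real W := by
    calc (P.prod (Measure.pi fun _ : Fin M ↦ ν)).real E
        ≤ (P.prod (Measure.pi fun _ : Fin M ↦ ν)).real ({ω | ∃ t, γ < X t ω} ×ˢ Set.univ) :=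
          measureReal_mono fun p ⟨i, hi⟩ ↦ ⟨⟨p.2 i, hi⟩, trivial⟩
      _ = P.real {ω | ∃ t, γ < X t ω} := by simp [measureReal_prod_prod]
      _ ≤ (1 + K * (a / b) * b) * P.real W := hK b (a / b) hb1 (by positivity) (by gcongr)
      _ ≤ (1 + ε) * P.real W := by
          rw [mul_assoc, div_mul_cancel₀ _ hb0.ne']
          gcongr
  set G : Set (Ω × S) := {z | γ < X z.2 z.1} with hG
  have mG : MeasurableSet G :=
    measurableSet_lt measurable_const ((measurable_uncurry_of_continuous_of_measurable cX mX).comp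
      measurable_swap)
  set p : ℝ := θ / 2 * L ^ (-(4 * D / β)) with hp
  have hN : P.real {ω | ω ∈ W ∧ ν.real {t | (ω, t) ∈ G} < p} ≤ ε / 2 * P.real W := by
    have h1 := hexc L (hbL.trans hLb1) b
    rw [← hab] at h1
    refine h1.trans (le_trans ?_ (mul_le_mul_of_nonneg_left hw (by positivity)))
    have h2 : C₃ * b ^ 2 + K' / ε ≤ c₁ * L ^ 2 := by
      have h3 : K' / ε ≤ K' * b ^ 2 / ε := by
        gcongr; exact le_mul_of_one_le_right hK'0.le (one_le_pow₀ hb1)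
      have h4 : C₃ * b ^ 2 ≤ C₃ * b ^ 2 / ε := le_div_self (by positivity) hε hε1
      calc C₃ * b ^ 2 + K' / ε ≤ (C₃ + K') * (b ^ 2 / ε) := by
            refine (add_le_add h4 h3).trans (le_of_eq (by ring))
        _ ≤ (b * c₁) * L := by gcongr
        _ ≤ L * c₁ * L := by gcongr
        _ = c₁ * L ^ 2 := by ring
    have h5 : Real.exp (-(K' / ε)) ≤ ε / K' := by
      rw [Real.exp_neg, inv_le_comm₀ (Real.exp_pos _) (by positivity), inv_div]
      linarith [Real.add_one_le_exp (K' / ε)]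
    calc C₁ * Real.exp (-(c₁ * L ^ 2)) ≤ C₁ * Real.exp (-(C₃ * b ^ 2) + -(K' / ε)) := by
          gcongr; linarith
      _ ≤ C₁ * (Real.exp (-(C₃ * b ^ 2)) * (ε / K')) := by rw [Real.exp_add]; gcongr
      _ = ε / 2 * (c₃ * Real.exp (-(C₃ * b ^ 2))) := by rw [hK']; field_simp
  have hpM : Real.exp (-(p * M)) ≤ ε / 2 := by
    have h1 : 2 / ε ≤ p * M := by
      have h2 : 1 ≤ L ^ (4 * v * D / β) := Real.one_le_rpow hL1 (by positivity)
      have h3 : L ^ (-(4 * D / β)) * L ^ ((4 + 4 * v) * (D : ℝ) / β) = L ^ (4 * v * D / β) := by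
        rw [← Real.rpow_add (by linarith)]; congr 1; ring
      calc 2 / ε ≤ 2 / ε * L ^ (4 * v * D / β) := le_mul_of_one_le_right (by positivity) h2
        _ = p * (4 / θ * ε⁻¹ * L ^ ((4 + 4 * v) * (D : ℝ) / β)) := by
            rw [← h3, hp]; field_simp; norm_num
        _ ≤ p * M := by
            rw [hM]
            have hp0 : 0 ≤ p := by positivity
            gcongr
            exact Nat.le_ceil _
    calc Real.exp (-(p * M)) ≤ Real.exp (-(2 / ε)) := by gcongr
      _ ≤ ε / 2 := by
        rw [Real.exp_neg, inv_le_comm₀ (Real.exp_pos _) (by positivity), inv_div]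
        linarith [Real.add_one_le_exp (2 / ε)]
  have hmiss := measureReal_prod_pi_forall_notMem_le P ν mG mW M p
  have hcover : P.real W ≤ (P.prod (Measure.pi fun _ : Fin M ↦ ν)).real E +
      (P.prod (Measure.pi fun _ : Fin M ↦ ν)).real {z | z.1 ∈ W ∧ ∀ i, (z.1, z.2 i) ∉ G} := by
    calc P.real W = (P.prod (Measure.pi fun _ : Fin M ↦ ν)).real (W ×ˢ Set.univ) := by
          simp [measureReal_prod_prod]
      _ ≤ (P.prod (Measure.pi fun _ : Fin M ↦ ν)).real
          (E ∪ {z | z.1 ∈ W ∧ ∀ i, (z.1, z.2 i) ∉ G}) := by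
          refine measureReal_mono fun z hz ↦ ?_
          by_cases h : z ∈ E
          · exact .inl h
          · exact .inr ⟨hz.1, fun i hi ↦ h ⟨i, hi⟩⟩
      _ ≤ _ := measureReal_union_le _ _
  have hexpW := mul_le_mul_of_nonneg_right hpM (measureReal_nonneg (μ := P) (s := W))
  rw [abs_le]
  constructor <;> linarith

lemma isGaussianProcess_of_sum_map_eq_gaussianReal {Ω ι : Type*} {mΩ : MeasurableSpace Ω}
    {P : Measure Ω} {X : ι → Ω → ℝ} (mX : ∀ t, Measurable (X t))
    (h : ∀ (n : ℕ) (t : Fin n → ι) (c : Fin n → ℝ), ∃ (m : ℝ) (v : NNReal),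
      P.map (fun ω ↦ ∑ i, c i * X (t i) ω) = gaussianReal m v) : IsGaussianProcess X P where
  hasGaussianLaw I := by
    refine ⟨isGaussian_of_map_eq_gaussianReal fun L ↦ ?_⟩
    have mI : Measurable fun ω ↦ I.restrict (X · ω) := measurable_pi_lambda _ fun i ↦ mX i
    obtain ⟨m, v, hmv⟩ := h I.card (fun i ↦ I.equivFin.symm i)
      fun i ↦ L (Pi.single (I.equivFin.symm i) 1)
    refine ⟨m, v, ?_⟩
    rw [Measure.map_map L.continuous.measurable mI, ← hmv]
    congr 1
    ext ω
    rw [Equiv.sum_comp I.equivFin.symm fun t ↦ L (Pi.single t 1) * X t ω]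
    change L (I.restrict (X · ω)) = _
    conv_lhs => rw [pi_eq_sum_univ' (I.restrict (X · ω)), map_sum]
    refine Finset.sum_congr rfl fun t _ ↦ ?_
    rw [map_smul, smul_eq_mul, mul_comm]
    rfl

lemma measure_prod_pi_exists_lt_eq {Ω E ι : Type*} [Fintype ι] [MeasurableSpace Ω]
    [MeasurableSpace E]
    (P : Measure Ω) [IsProbabilityMeasure P] {T : Set E} (hT : MeasurableSet T)
    (ν : Measure T) [IsProbabilityMeasure ν] {X : T → Ω → ℝ} {f : E → Ω → ℝ}
    (mX : Measurable (Function.uncurry X)) (hXf : ∀ᵐ ω ∂P, ∀ t : T, X t ω = f t ω) (y : ℝ) :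
    (P.prod (Measure.pi fun _ : ι ↦ ν.map Subtype.val)) {p | ∃ i, y < f (p.2 i) p.1} =
      (P.prod (Measure.pi fun _ : ι ↦ ν)) {p | ∃ i, y < X (p.2 i) p.1} := by
  have : IsProbabilityMeasure (ν.map Subtype.val) :=
    Measure.isProbabilityMeasure_map measurable_subtype_coe.aemeasurable
  have hTE : MeasurableEmbedding (Subtype.val : T → E) := .subtype_coe hT
  set A : Set (E × Ω) := Prod.map Subtype.val id '' {z : T × Ω | y < X z.1 z.2} with hA
  have mA : MeasurableSet A :=
    (hTE.prodMap .id).measurableSet_image.2 (measurableSet_lt measurable_const mX)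
  set B : Set (Ω × (ι → E)) := {p | ∃ i, (p.2 i, p.1) ∈ A} with hB
  have mB : MeasurableSet B := by
    have : B = ⋃ i, (fun p : Ω × (ι → E) ↦ (p.2 i, p.1)) ⁻¹' A := by ext; simp [hB]
    rw [this]
    exact .iUnion fun i ↦ (by fun_prop : Measurable fun p : Ω × (ι → E) ↦ (p.2 i, p.1)) mA
  have hΦ : MeasurePreserving (Prod.map id fun (u : ι → T) i ↦ (u i : E))
      (P.prod (Measure.pi fun _ : ι ↦ ν))
      (P.prod (Measure.pi fun _ : ι ↦ ν.map Subtype.val)) :=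
    (MeasurePreserving.id P).prod
      (measurePreserving_pi _ _ fun _ ↦ measurable_subtype_coe.measurePreserving ν)
  have hae : ∀ᵐ p ∂(P.prod (Measure.pi fun _ : ι ↦ ν.map Subtype.val)),
      (∀ t : T, X t p.1 = f t p.1) ∧ ∀ i, p.2 i ∈ T := by
    refine (Measure.quasiMeasurePreserving_fst.ae hXf).and (ae_all_iff.2 fun i ↦ ?_)
    have h1 : ∀ᵐ x ∂ν.map Subtype.val, x ∈ T :=
      (ae_map_iff measurable_subtype_coe.aemeasurable hT).2 (ae_of_all _ fun t ↦ t.2)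
    exact Measure.quasiMeasurePreserving_snd.ae
      ((Measure.quasiMeasurePreserving_eval (fun _ ↦ ν.map Subtype.val) i).ae h1)
  have hEB : {p : Ω × (ι → E) | ∃ i, y < f (p.2 i) p.1} =ᵐ[
      P.prod (Measure.pi fun _ : ι ↦ ν.map Subtype.val)] B := by
    filter_upwards [hae] with p ⟨hp1, hp2⟩
    refine propext (exists_congr fun i ↦ ?_)
    have h : f (p.2 i) p.1 = X ⟨p.2 i, hp2 i⟩ p.1 := (hp1 ⟨p.2 i, hp2 i⟩).symm
    rw [h]
    refine ⟨fun h ↦ ⟨(⟨p.2 i, hp2 i⟩, p.1), h, rfl⟩, ?_⟩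
    rintro ⟨⟨t, ω⟩, h, hz⟩
    obtain ⟨h1, rfl⟩ := Prod.ext_iff.1 hz
    obtain rfl : t = ⟨p.2 i, hp2 i⟩ := Subtype.ext h1
    exact h
  rw [measure_congr hEB, ← hΦ.measure_preimage mB.nullMeasurableSet]
  congr 1
  ext ⟨ω, u⟩
  refine exists_congr fun i ↦ ?_
  exact (hTE.injective.prodMap Function.injective_id).mem_set_image (a := (u i, ω))

lemma exists_continuous_modification {Ω E : Type*} [TopologicalSpace E]
    {mΩ : MeasurableSpace Ω}
    {P : Measure Ω} {T : Set E} {f : E → Ω → ℝ} (mf : ∀ t, Measurable (f t))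
    (hf : ∀ᵐ ω ∂P, ContinuousOn (f · ω) T) :
    ∃ X : T → Ω → ℝ, (∀ t, Measurable (X t)) ∧ (∀ ω, Continuous (X · ω)) ∧
      ∀ᵐ ω ∂P, ∀ t : T, X t ω = f t ω := by
  obtain ⟨G, hG, mG, hPG⟩ := exists_measurable_superset_of_null hf
  refine ⟨fun t ω ↦ if ω ∈ G then 0 else f t ω, fun t ↦ .ite mG measurable_const (mf t),
    fun ω ↦ ?_, ?_⟩
  · by_cases hω : ω ∈ G
    · simpa [hω] using continuous_const
    · simp only [hω, if_false]
      exact continuousOn_iff_continuous_domRestrict.1 (by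
        by_contra h
        exact hω (hG h))
  · filter_upwards [measure_eq_zero_iff_ae_notMem.1 hPG] with ω hω t
    simp [hω]

lemma continuous_nrm {d : ℕ} : Continuous (nrm : (Fin d → ℝ) → ℝ) := by
  unfold nrm; fun_prop

lemma nrm_zero {d : ℕ} : nrm (0 : Fin d → ℝ) = 0 := by simp [nrm]

lemma nrm_nonneg {d : ℕ} (x : Fin d → ℝ) : 0 ≤ nrm x := Finset.sum_nonneg fun _ _ ↦ abs_nonneg _

lemma norm_le_nrm {d : ℕ} (x : Fin d → ℝ) : ‖x‖ ≤ nrm x :=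
  (pi_norm_le_iff_of_nonneg (nrm_nonneg x)).2 fun i ↦
    Finset.single_le_sum (f := fun j ↦ |x j|) (fun _ _ ↦ abs_nonneg _) (Finset.mem_univ i)

lemma nrm_le_mul_norm {d : ℕ} (x : Fin d → ℝ) : nrm x ≤ d * ‖x‖ := by
  have := Finset.sum_le_card_nsmul Finset.univ (fun j ↦ |x j|) ‖x‖ fun i _ ↦ norm_le_pi_norm x i
  simpa [nrm] using this

lemma volume_real_nrm_le_one_pos (d : ℕ) : 0 < volume.real {x : Fin d → ℝ | nrm x ≤ 1} := by
  refine ENNReal.toReal_pos (ne_of_gt ?_) (ne_of_lt ?_)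
  · refine lt_of_lt_of_le (IsOpen.measure_pos volume (isOpen_lt continuous_nrm continuous_const)
      ⟨0, by simp [nrm_zero]⟩) (measure_mono fun x (hx : nrm x < 1) ↦ hx.le)
  · refine lt_of_le_of_lt (measure_mono fun x hx ↦ ?_)
      (measure_closedBall_lt_top (x := (0 : Fin d → ℝ)) (r := 1))
    exact mem_closedBall_zero_iff.2 ((norm_le_nrm x).trans hx)

/-- Theorem `PropFinalHolder`, bias part.  Under Conditions A1–A4 with
Hölder exponent `β`, fix `v > 0` and set `ρ = 2d/β + dv + 1`,
`w(b) = P(max_{t∈T} f(t) > b)`, and, for i.i.d. uniform `U₁,…,U_M` on `T` independent of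
`f` (realized on the product space `Ω × T^M`), `w_M(γ) = P(max_i f(U_i) > γ)`.  There are
constants `λ, c, b₀, ε₀ > 0` such that for all `ε ∈ (0, ε₀]` and `b ≥ b₀`, choosing
`a = ε/(4λb^ρ)` and `M = ⌈c ε⁻¹ (b/a)^{(4+4v)d/β}⌉`, one has
`|w(b) − w_M(γ_{a,b})| ≤ ε w(b)`, where `γ_{a,b} = b − a/b`. -/
theorem relative_bias_control
    {Ω : Type} [MeasureSpace Ω] [IsProbabilityMeasure (ℙ : Measure Ω)]
    {d : ℕ} (hd : 0 < d)
    (T : Set (Fin d → ℝ)) (hTcompact : IsCompact T) (h0T : (0 : Fin d → ℝ) ∈ T)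
    (f : (Fin d → ℝ) → Ω → ℝ) (hfmeas : ∀ t, Measurable (f t))
    -- `f` is a Gaussian random field on `T`
    (hGauss : ∀ (n : ℕ) (t : Fin n → (Fin d → ℝ)), (∀ i, t i ∈ T) →
      ∀ c : Fin n → ℝ, ∃ (m : ℝ) (v : NNReal),
        Measure.map (fun ω => ∑ i, c i * f (t i) ω) (ℙ : Measure Ω) = gaussianReal m v)
    -- mean, covariance and standard deviation functions
    (μ : (Fin d → ℝ) → ℝ) (C : (Fin d → ℝ) → (Fin d → ℝ) → ℝ) (σ : (Fin d → ℝ) → ℝ)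
    (hμ : ∀ t ∈ T, μ t = ∫ ω, f t ω)
    (hC : ∀ s ∈ T, ∀ t ∈ T, C s t = ∫ ω, (f s ω - μ s) * (f t ω - μ t))
    (hσ : ∀ t ∈ T, σ t = Real.sqrt (C t t)) (hσpos : ∀ t ∈ T, 0 < σ t)
    -- Condition A1: almost sure continuity on T
    (hA1 : ∀ᵐ ω ∂(ℙ : Measure Ω), ContinuousOn (fun t => f t ω) T)
    -- Conditions A2 and A3, with Hölder exponent `β` and constant `κH`
    (β κH δ : ℝ) (hβ : 0 < β) (hκH : 0 < κH) (hδ : 0 < δ)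
    (hA2 : ∀ s ∈ T, ∀ t ∈ T, nrm (s - t) < δ →
      |σ t - σ s| + |μ t - μ s| ≤ κH * nrm (s - t) ^ β)
    (hA3 : ∀ s ∈ T, ∀ s' ∈ T, ∀ t ∈ T, ∀ t' ∈ T,
      nrm (t - t') < δ → nrm (s - s') < δ →
      |C t s / (σ t * σ s) - C t' s' / (σ t' * σ s')| ≤
        κH * (nrm (t - t') ^ β + nrm (s - s') ^ β))
    -- Condition A4
    (κ₀ ε₁ : ℝ) (hκ₀ : 0 < κ₀) (hε₁ : 0 < ε₁)
    (hA4 : ∀ t ∈ T, ∀ ε : ℝ, 0 < ε → ε < ε₁ →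
      κ₀ * ε ^ d * (volume {x : Fin d → ℝ | nrm x ≤ 1}).toReal ≤
        (volume ({s | nrm (s - t) ≤ ε} ∩ T)).toReal)
    -- `ν` is the uniform distribution on `T`
    (ν : Measure (Fin d → ℝ)) [IsProbabilityMeasure ν]
    (hν : ν = (volume T)⁻¹ • volume.restrict T) :
    ∀ v : ℝ, 0 < v →
      ∃ lam c b₀ ε₀ : ℝ, 0 < lam ∧ 0 < c ∧ 0 < b₀ ∧ 0 < ε₀ ∧
        ∀ ε : ℝ, 0 < ε → ε ≤ ε₀ → ∀ b : ℝ, b₀ ≤ b →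
          let a : ℝ := ε / (4 * lam * b ^ (2 * (d : ℝ) / β + (d : ℝ) * v + 1));
          let M : ℕ := Nat.ceil (c * ε⁻¹ * (b / a) ^ ((4 + 4 * v) * (d : ℝ) / β));
          |(ℙ {ω | ∃ t ∈ T, f t ω > b}).toReal -
              (((ℙ : Measure Ω).prod (Measure.pi fun _ : Fin M => ν))
                {p | ∃ i, f (p.2 i) p.1 > b - a / b}).toReal|
            ≤ ε * (ℙ {ω | ∃ t ∈ T, f t ω > b}).toReal := by
  intro v hv
  have hTm : MeasurableSet T := hTcompact.measurableSet
  have : CompactSpace T := isCompact_iff_compactSpace.1 hTcompact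
  have hvolT : 0 < volume.real T := by
    refine ENNReal.toReal_pos (fun h ↦ ?_) hTcompact.measure_lt_top.ne
    have h1 : ν Set.univ = 1 := measure_univ
    simp [hν, h] at h1
  set ν' : Measure T := ν.comap Subtype.val with hν'
  have hmap : ν'.map Subtype.val = ν := by
    rw [hν', map_comap_subtype_coe hTm, hν, Measure.restrict_smul, Measure.restrict_restrict hTm,
      Set.inter_self]
  have : IsProbabilityMeasure (ν'.map Subtype.val) := by rw [hmap]; infer_instance
  have : IsProbabilityMeasure ν' := Measure.isProbabilityMeasure_of_map Subtype.val
  obtain ⟨X, mX, cX, hXf⟩ := exists_continuous_modification hfmeas hA1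
  have hXf' (t : T) : X t =ᵐ[ℙ] f t := hXf.mono fun ω hω ↦ hω t
  have hX : IsGaussianProcess X ℙ :=
    (isGaussianProcess_of_sum_map_eq_gaussianReal (X := fun t : T ↦ f t) (fun t ↦ hfmeas t)
      fun n t c ↦ hGauss n (fun i ↦ t i) (fun i ↦ (t i).2) c).congr fun t ↦ (hXf' t).symm
  have hmean (t : T) : ∫ ω, X t ω = μ t := by rw [hμ t t.2]; exact integral_congr_ae (hXf' t)
  have hcovX (s t : T) : cov[X s, X t; ℙ] = C s t := by
    rw [covariance, hmean, hmean, hC s s.2 t t.2]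
    refine integral_congr_ae ?_
    filter_upwards [hXf] with ω hω
    rw [hω, hω]
  have hCσ (t : T) : C t t = σ t ^ 2 := by
    have h := hσpos t t.2
    rw [hσ t t.2] at h ⊢
    rw [Real.sq_sqrt (Real.sqrt_pos.1 h).le]
  have hvarX (t : T) : Var[X t; ℙ] = σ t ^ 2 := by
    rw [← covariance_self (mX t).aemeasurable, hcovX, hCσ]
  have hcorr (s t : T) (hst : nrm (s - t : Fin d → ℝ) < δ) :
      |C t s / (σ t * σ s) - 1| ≤ κH * nrm (s - t : Fin d → ℝ) ^ β := by
    have h := hA3 s s.2 t t.2 t t.2 t t.2 (by simpa [nrm_zero] using hδ) hst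
    rwa [sub_self, nrm_zero, Real.zero_rpow hβ.ne', zero_add, hCσ, ← sq,
      div_self (pow_ne_zero 2 (hσpos t t.2).ne')] at h
  have hCr (s t : T) : C t s = C t s / (σ t * σ s) * σ t * σ s := by
    have := hσpos s s.2
    have := hσpos t t.2
    field_simp
  have hnear (t₀ : T) : ∀ᶠ t : T in nhds t₀, nrm (t₀ - t : Fin d → ℝ) < δ := by
    have h : Continuous fun t : T ↦ nrm (t₀ - t : Fin d → ℝ) := continuous_nrm.comp (by fun_prop)
    exact h.continuousAt.eventually (gt_mem_nhds (by simpa [nrm_zero] using hδ))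
  have hrate (t₀ : T) :
      Tendsto (fun t : T ↦ κH * nrm (t₀ - t : Fin d → ℝ) ^ β) (nhds t₀) (nhds 0) := by
    have h : Continuous fun t : T ↦ κH * nrm (t₀ - t : Fin d → ℝ) ^ β :=
      continuous_const.mul ((continuous_nrm.comp (by fun_prop)).rpow_const fun _ ↦ .inr hβ.le)
    simpa [nrm_zero, Real.zero_rpow hβ.ne'] using h.tendsto t₀
  have hσc : Continuous fun t : T ↦ σ t := by
    refine continuous_iff_continuousAt.2 fun t₀ ↦ ?_
    rw [ContinuousAt, tendsto_iff_dist_tendsto_zero]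
    refine squeeze_zero' (.of_forall fun _ ↦ dist_nonneg) ?_ (hrate t₀)
    filter_upwards [hnear t₀] with t ht
    exact (le_add_of_nonneg_right (abs_nonneg _)).trans (hA2 t₀ t₀.2 t t.2 ht)
  have hcov (t₀ : T) : ContinuousAt (fun t ↦ cov[X t, X t₀; ℙ]) t₀ := by
    have hr : Tendsto (fun t : T ↦ C t t₀ / (σ t * σ t₀)) (nhds t₀) (nhds 1) := by
      rw [tendsto_iff_dist_tendsto_zero]
      refine squeeze_zero' (.of_forall fun _ ↦ dist_nonneg) ?_ (hrate t₀)
      filter_upwards [hnear t₀] with t ht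
      exact hcorr t₀ t ht
    have h := (hr.mul (hσc.tendsto t₀)).mul_const (σ t₀)
    rw [ContinuousAt, hcovX, hCσ]
    convert h using 2
    · rw [hcovX]; exact hCr _ _
    · ring
  obtain ⟨B, hB⟩ : ∃ B, ∀ t : T, σ t ≤ B := by
    obtain ⟨B, hB⟩ := (isCompact_range hσc).bddAbove
    exact ⟨B, fun t ↦ hB ⟨t, rfl⟩⟩
  have hd0 : (0 : ℝ) < d := by exact_mod_cast hd
  set κ : ℝ := (κH + κH ^ 2 + 2 * B ^ 2 * κH) * d ^ β with hκ
  have hinc (s t : T) (hst : dist s t < min δ 1 / d) :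
      |(∫ ω, X t ω) - ∫ ω, X s ω| ≤ κ * dist s t ^ β ∧ Var[X t - X s; ℙ] ≤ κ * dist s t ^ β := by
    set N : ℝ := nrm (s - t : Fin d → ℝ) with hN
    have hN0 : 0 ≤ N := nrm_nonneg _
    have hNd : N ≤ d * dist s t := by
      rw [Subtype.dist_eq, dist_eq_norm]; exact nrm_le_mul_norm _
    have hN1 : N < min δ 1 := hNd.trans_lt (by rwa [lt_div_iff₀' hd0] at hst)
    have hNδ : N < δ := hN1.trans_le (min_le_left _ _)
    have hNβ : N ^ β ≤ d ^ β * dist s t ^ β := by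
      rw [← Real.mul_rpow hd0.le dist_nonneg]; gcongr
    have hNβ1 : N ^ β ≤ 1 := Real.rpow_le_one hN0 (hN1.trans_le (min_le_right _ _)).le hβ.le
    have hNβ0 : 0 ≤ N ^ β := by positivity
    have hA := hA2 s s.2 t t.2 hNδ
    have hκN : (κH + κH ^ 2 + 2 * B ^ 2 * κH) * N ^ β ≤ κ * dist s t ^ β := by
      rw [hκ, mul_assoc _ ((d : ℝ) ^ β)]; gcongr
    refine ⟨le_trans ?_ hκN, le_trans ?_ hκN⟩
    · rw [hmean, hmean]
      calc |μ t - μ s| ≤ κH * N ^ β := (le_add_of_nonneg_left (abs_nonneg _)).trans hA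
        _ ≤ (κH + κH ^ 2 + 2 * B ^ 2 * κH) * N ^ β := by
          gcongr
          have : 0 ≤ κH ^ 2 + 2 * B ^ 2 * κH := by positivity
          linarith
    · have hLs := (hX.hasGaussianLaw_eval s).memLp_two
      have hLt := (hX.hasGaussianLaw_eval t).memLp_two
      have hvar : Var[X t - X s; ℙ] = (σ t - σ s) ^ 2 +
          2 * (σ t * σ s) * (1 - C t s / (σ t * σ s)) := by
        rw [variance_sub hLt hLs, hvarX, hvarX, hcovX]
        have := hσpos s s.2
        have := hσpos t t.2
        field_simp
        ring
      have h1 : (σ t - σ s) ^ 2 ≤ κH ^ 2 * N ^ β := by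
        calc (σ t - σ s) ^ 2 = |σ t - σ s| ^ 2 := (sq_abs _).symm
          _ ≤ (κH * N ^ β) ^ 2 := by
            gcongr; exact (le_add_of_nonneg_right (abs_nonneg _)).trans hA
          _ = κH ^ 2 * (N ^ β * N ^ β) := by ring
          _ ≤ κH ^ 2 * (N ^ β * 1) := by gcongr
          _ = κH ^ 2 * N ^ β := by ring
      have h2 : 1 - C t s / (σ t * σ s) ≤ κH * N ^ β := by
        linarith [neg_abs_le (C t s / (σ t * σ s) - 1), hcorr s t hNδ]
      have h3 : σ t * σ s ≤ B ^ 2 := by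
        rw [sq]
        exact mul_le_mul (hB t) (hB s) (hσpos s s.2).le ((hσpos t t.2).le.trans (hB t))
      have h4 : 0 < σ t * σ s := mul_pos (hσpos t t.2) (hσpos s s.2)
      calc Var[X t - X s; ℙ] ≤ κH ^ 2 * N ^ β + 2 * B ^ 2 * (κH * N ^ β) := by
            rw [hvar]
            refine add_le_add h1 ?_
            calc 2 * (σ t * σ s) * (1 - C t s / (σ t * σ s)) ≤ 2 * (σ t * σ s) * (κH * N ^ β) := by
                  gcongr
              _ ≤ 2 * B ^ 2 * (κH * N ^ β) := by gcongr
        _ ≤ (κH + κH ^ 2 + 2 * B ^ 2 * κH) * N ^ β := by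
            have : 0 ≤ κH * N ^ β := by positivity
            linarith
  have hball (t : T) (r : ℝ) (hr : 0 < r) (hr1 : r < ε₁) :
      κ₀ * volume.real {x : Fin d → ℝ | nrm x ≤ 1} / volume.real T * r ^ d ≤
        ν'.real (Metric.closedBall t r) := by
    have h1 : ν'.real (Metric.closedBall t r) =
        volume.real (Metric.closedBall (t : Fin d → ℝ) r ∩ T) / volume.real T := by
      have h : ν'.real (Metric.closedBall t r) =
          (ν'.map Subtype.val).real (Metric.closedBall (t : Fin d → ℝ) r) := by
        rw [map_measureReal_apply measurable_subtype_coe Metric.isClosed_closedBall.measurableSet]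
        rfl
      rw [h, hmap, hν, measureReal_ennreal_smul_apply, measureReal_restrict_apply
        Metric.isClosed_closedBall.measurableSet, ENNReal.toReal_inv, ← measureReal_def]
      ring
    rw [h1, div_mul_eq_mul_div]
    gcongr
    calc κ₀ * volume.real {x : Fin d → ℝ | nrm x ≤ 1} * r ^ d
        = κ₀ * r ^ d * volume.real {x : Fin d → ℝ | nrm x ≤ 1} := by ring
      _ ≤ volume.real ({s : Fin d → ℝ | nrm (s - (t : Fin d → ℝ)) ≤ r} ∩ T) := hA4 t t.2 r hr hr1
      _ ≤ volume.real (Metric.closedBall (t : Fin d → ℝ) r ∩ T) := by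
        refine measureReal_mono (Set.inter_subset_inter_left _ fun s hs ↦ ?_)
          (ne_top_of_le_ne_top hTcompact.measure_lt_top.ne (measure_mono Set.inter_subset_right))
        rw [Metric.mem_closedBall, dist_eq_norm]
        exact (norm_le_nrm _).trans hs
  have hV := volume_real_nrm_le_one_pos d
  obtain ⟨lam, c, b₀, hlam, hc, hb₀, h⟩ := hX.exists_abs_measureReal_sub_le mX cX
    (fun t ↦ by rw [hvarX]; exact pow_pos (hσpos t t.2) 2) hcov ν' hβ (by positivity)
    (by positivity) (by positivity) hε₁ hinc hball hv
  refine ⟨lam, c, b₀, 1, hlam, hc, hb₀, one_pos, fun ε hε hε1 b hb ↦ ?_⟩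
  intro a M
  have hw : (ℙ {ω | ∃ t ∈ T, f t ω > b}).toReal = (ℙ : Measure Ω).real {ω | ∃ t, b < X t ω} := by
    refine measureReal_congr ?_
    filter_upwards [hXf] with ω hω
    refine propext ⟨fun ⟨t, ht, h⟩ ↦ ⟨⟨t, ht⟩, ?_⟩, fun ⟨t, h⟩ ↦ ⟨t, t.2, ?_⟩⟩
    · rwa [hω]
    · rwa [gt_iff_lt, ← hω]
  have hwM := measure_prod_pi_exists_lt_eq (ι := Fin M) ℙ hTm ν'
    (measurable_uncurry_of_continuous_of_measurable cX mX) hXf (b - a / b)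
  rw [hmap] at hwM
  rw [hw]
  simp only [gt_iff_lt]
  rw [hwM]
  exact h ε hε hε1 b hb a rfl M rfl
end
end

section
/- Let X = (X₁,…,X_M) be a centered Gaussian vector in ℝ^M with nonsingular covariance matrix. Then P( there exist i ≠ j with X_i > b and X_j > b | max_{1≤k≤M} X_k > b ) → 0 as b → ∞; that is, conditional on the maximum exceeding b, with probability tending to one exactly one coordinate exceeds b. -/
open MeasureTheory ProbabilityTheory Filter

lemma gaussianReal_real_Ioi_le (v : NNReal) {t : ℝ} (ht : 0 ≤ t) (b : ℝ) :
    (gaussianReal 0 v).real (Set.Ioi b) ≤ Real.exp (-t * b + v * t ^ 2 / 2) := by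
  have h := measure_ge_le_exp_mul_mgf (μ := gaussianReal 0 v) (X := id) b ht
    (integrable_exp_mul_gaussianReal t)
  rw [mgf_id_gaussianReal, ← Real.exp_add, zero_mul, zero_add] at h
  exact le_trans (measureReal_mono (fun _ hx => le_of_lt (Set.mem_Ioi.1 hx))) h

lemma gaussianPDFReal_add_one_le_real_Ioi {w : NNReal} (hw : w ≠ 0) {b : ℝ} (hb : 0 ≤ b) :
    gaussianPDFReal 0 w (b + 1) ≤ (gaussianReal 0 w).real (Set.Ioi b) := by
  have hIoc : gaussianPDFReal 0 w (b + 1) ≤ (gaussianReal 0 w).real (Set.Ioc b (b + 1)) := by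
    rw [measureReal_def, gaussianReal_apply_eq_integral 0 hw, ENNReal.toReal_ofReal
      (integral_nonneg fun x => gaussianPDFReal_nonneg 0 w x)]
    have h := setIntegral_mono_on (μ := volume) (s := Set.Ioc b (b + 1))
      (f := fun _ => gaussianPDFReal 0 w (b + 1)) (g := gaussianPDFReal 0 w)
      (by simp) (integrable_gaussianPDFReal 0 w).integrableOn measurableSet_Ioc
      (fun x hx => by
        have hx0 : 0 ≤ x := hb.trans hx.1.le
        simp only [gaussianPDFReal, sub_zero]
        gcongr
        exact hx.2)
    simpa using h
  exact hIoc.trans (measureReal_mono fun _ hx => hx.1)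

lemma tendsto_gaussianReal_real_Ioi_div {v w : NNReal} (hvw : v < w) :
    Tendsto (fun b : ℝ => (gaussianReal 0 v).real (Set.Ioi b) / (gaussianReal 0 w).real (Set.Ioi b))
      atTop (nhds 0) := by
  have hw : 0 < (w : ℝ) := by exact_mod_cast (zero_le.trans_lt hvw)
  have hw0 : w ≠ 0 := (zero_le.trans_lt hvw).ne'
  have hvw' : (v : ℝ) < w := by exact_mod_cast hvw
  have hk : 0 < ((w : ℝ) - v) / (2 * w ^ 2) := by
    have := sub_pos.2 hvw'
    positivity
  have hlin : Tendsto (fun b : ℝ => 1 / (w : ℝ) - ((w : ℝ) - v) / (2 * w ^ 2) * b) atTop atBot :=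
    tendsto_const_nhds.add_atBot (tendsto_neg_atTop_atBot.comp (tendsto_id.const_mul_atTop hk))
  have hexp : Tendsto (fun b : ℝ => √(2 * Real.pi * w) * Real.exp
      (b * (1 / (w : ℝ) - ((w : ℝ) - v) / (2 * w ^ 2) * b) + 1 / (2 * w))) atTop (nhds 0) := by
    simpa using (Real.tendsto_exp_atBot.comp (tendsto_atBot_add_const_right _ (1 / (2 * (w : ℝ)))
      (tendsto_id.atTop_mul_atBot₀ hlin))).const_mul √(2 * Real.pi * w)
  refine squeeze_zero' (.of_forall fun b => by positivity) ?_ hexp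
  filter_upwards [eventually_ge_atTop 0] with b hb
  have hpdf := gaussianPDFReal_pos 0 w (b + 1) hw0
  calc
    _ ≤ Real.exp (-(b / w) * b + v * (b / w) ^ 2 / 2) / gaussianPDFReal 0 w (b + 1) := by
        gcongr
        · exact gaussianReal_real_Ioi_le v (by positivity) b
        · exact gaussianPDFReal_add_one_le_real_Ioi hw0 hb
    _ = _ := by
        rw [gaussianPDFReal, div_eq_iff (by positivity), mul_mul_mul_comm,
          mul_inv_cancel₀ (by positivity), one_mul, ← Real.exp_add]
        congr 1
        field_simp
        ring

lemma integral_sq_of_map_eq_gaussianReal {Ω : Type*} [MeasurableSpace Ω] {μ : Measure Ω}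
    {Y : Ω → ℝ} (hY : Measurable Y) {v : NNReal} (h : μ.map Y = gaussianReal 0 v) :
    ∫ ω, Y ω ^ 2 ∂μ = v := by
  rw [← integral_map (f := fun x : ℝ => x ^ 2) hY.aemeasurable (by fun_prop), h,
    ← variance_of_integral_eq_zero aemeasurable_id' (by simp), variance_fun_id_gaussianReal]

lemma memLp_two_of_map_eq_gaussianReal {Ω : Type*} [MeasurableSpace Ω] {μ : Measure Ω}
    {Y : Ω → ℝ} (hY : Measurable Y) {v : NNReal} (h : μ.map Y = gaussianReal 0 v) :
    MemLp Y 2 μ := by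
  have := memLp_id_gaussianReal (μ := 0) (v := v) 2
  rw [← h] at this
  exact this.comp_of_map hY.aemeasurable

/-- The average of two jointly Gaussian variables that are not almost surely equal has smaller
variance than one of them, and it exceeds any level that they both exceed. -/
lemma tendsto_measureReal_both_gt_div {Ω : Type*} [MeasurableSpace Ω] {μ : Measure Ω}
    [IsFiniteMeasure μ] {Y Z : Ω → ℝ} (hY : Measurable Y) (hZ : Measurable Z) {u v w : NNReal}
    (hYu : μ.map Y = gaussianReal 0 u) (hZv : μ.map Z = gaussianReal 0 v)
    (hw : μ.map (fun ω => (Y ω + Z ω) / 2) = gaussianReal 0 w)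
    (hne : 0 < ∫ ω, (Y ω - Z ω) ^ 2 ∂μ) (S : ℝ → Set Ω) (hYS : ∀ b, {ω | Y ω > b} ⊆ S b)
    (hZS : ∀ b, {ω | Z ω > b} ⊆ S b) :
    Tendsto (fun b : ℝ => μ.real {ω | Y ω > b ∧ Z ω > b} / μ.real (S b)) atTop (nhds 0) := by
  have hYm := memLp_two_of_map_eq_gaussianReal hY hYu
  have hZm := memLp_two_of_map_eq_gaussianReal hZ hZv
  have hsum : (∫ ω, ((Y ω + Z ω) / 2) ^ 2 ∂μ) + (∫ ω, (Y ω - Z ω) ^ 2 ∂μ) / 4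
      = ((∫ ω, Y ω ^ 2 ∂μ) + ∫ ω, Z ω ^ 2 ∂μ) / 2 := by
    have h₁ : Integrable (fun ω => ((Y ω + Z ω) / 2) ^ 2) μ :=
      (memLp_two_of_map_eq_gaussianReal (by fun_prop) hw).integrable_sq
    have h₂ : Integrable (fun ω => (Y ω - Z ω) ^ 2) μ := (hYm.sub hZm).integrable_sq
    rw [← integral_div, ← integral_add h₁ (h₂.div_const 4),
      ← integral_add hYm.integrable_sq hZm.integrable_sq, ← integral_div]
    congr 1 with ω
    ring
  rw [integral_sq_of_map_eq_gaussianReal hY hYu, integral_sq_of_map_eq_gaussianReal hZ hZv,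
    integral_sq_of_map_eq_gaussianReal (by fun_prop) hw] at hsum
  have hupper (b : ℝ) : μ.real {ω | Y ω > b ∧ Z ω > b} ≤ (gaussianReal 0 w).real (Set.Ioi b) := by
    rw [← hw, map_measureReal_apply (by fun_prop) measurableSet_Ioi]
    refine measureReal_mono fun ω hω => ?_
    simp only [Set.mem_ofPred_eq, Set.mem_preimage, Set.mem_Ioi] at hω ⊢
    linarith [hω.1, hω.2]
  have key {s : NNReal} {V : Ω → ℝ} (hV : Measurable V) (hVs : μ.map V = gaussianReal 0 s)
      (hVS : ∀ b, {ω | V ω > b} ⊆ S b) (hws : w < s) :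
      Tendsto (fun b : ℝ => μ.real {ω | Y ω > b ∧ Z ω > b} / μ.real (S b)) atTop (nhds 0) := by
    refine squeeze_zero' (.of_forall fun b => by positivity) ?_
      (tendsto_gaussianReal_real_Ioi_div hws)
    filter_upwards [eventually_ge_atTop 0] with b hb
    have hs : s ≠ 0 := (zero_le.trans_lt hws).ne'
    have hpos : 0 < (gaussianReal 0 s).real (Set.Ioi b) :=
      (gaussianPDFReal_pos 0 s (b + 1) hs).trans_le (gaussianPDFReal_add_one_le_real_Ioi hs hb)
    have hlower : (gaussianReal 0 s).real (Set.Ioi b) ≤ μ.real (S b) := by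
      rw [← hVs, map_measureReal_apply hV measurableSet_Ioi]
      exact measureReal_mono (hVS b)
    exact div_le_div₀ measureReal_nonneg (hupper b) hpos hlower
  rcases lt_or_ge w u with hwu | huw
  · exact key hY hYu hYS hwu
  · refine key hZ hZv hZS ?_
    have : (u : ℝ) ≤ w := by exact_mod_cast huw
    have : (w : ℝ) < v := by linarith
    exact_mod_cast this

/-- For a centered Gaussian vector `X` in `ℝ^M` with nonsingular
(positive definite) covariance matrix, the conditional probability, given
`max_k X_k > b`, that two distinct coordinates exceed `b` tends to `0` as `b → ∞`:
conditional on the maximum exceeding `b`, with probability tending to one exactly one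
coordinate exceeds `b`. -/
theorem conditional_probability_two_exceedances_tendsto_zero
    {Ω : Type} [MeasureSpace Ω] [IsProbabilityMeasure (ℙ : Measure Ω)]
    {M : ℕ} (hM : 0 < M)
    (X : Ω → Fin M → ℝ) (hX : Measurable X)
    (hGauss : ∀ c : Fin M → ℝ, ∃ v : NNReal,
      Measure.map (fun ω => ∑ i, c i * X ω i) (ℙ : Measure Ω) = gaussianReal 0 v)
    (hpos : Matrix.PosDef (Matrix.of fun i j : Fin M => ∫ ω, X ω i * X ω j)) :
    Tendsto
      (fun b : ℝ =>
        (ℙ {ω | ∃ i j, i ≠ j ∧ X ω i > b ∧ X ω j > b}).toReal /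
          (ℙ {ω | ∃ k, X ω k > b}).toReal)
      atTop (nhds 0) := by
  classical
  have hXm (i : Fin M) : Measurable fun ω => X ω i := (measurable_pi_apply i).comp hX
  have hmap (i : Fin M) : ∃ v : NNReal, (ℙ : Measure Ω).map (fun ω => X ω i) = gaussianReal 0 v := by
    simpa [Pi.single_apply] using hGauss (Pi.single i 1)
  have hmem (i : Fin M) : MemLp (fun ω => X ω i) 2 (ℙ : Measure Ω) :=
    memLp_two_of_map_eq_gaussianReal (hXm i) (hmap i).choose_spec
  have hpair (i j : Fin M) (hij : i ≠ j) :
      Tendsto (fun b : ℝ => (ℙ : Measure Ω).real {ω | X ω i > b ∧ X ω j > b} /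
        (ℙ : Measure Ω).real {ω | ∃ k, X ω k > b}) atTop (nhds 0) := by
    obtain ⟨u, hu⟩ := hmap i
    obtain ⟨v, hv⟩ := hmap j
    obtain ⟨w, hw⟩ := hGauss (Pi.single i (1 / 2) + Pi.single j (1 / 2))
    have hne : 0 < ∫ ω, (X ω i - X ω j) ^ 2 := by
      have h := hpos.dotProduct_mulVec_pos (x := Pi.single i 1 - Pi.single j 1) (fun h => by
        simpa [hij] using congrFun h i)
      have hint (k l : Fin M) : Integrable (fun ω => X ω k * X ω l) (ℙ : Measure Ω) :=
        (hmem k).integrable_mul (hmem l)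
      have hexpand : ∫ ω, (X ω i - X ω j) ^ 2 = (∫ ω, X ω i * X ω i) - (∫ ω, X ω j * X ω i)
          - ((∫ ω, X ω i * X ω j) - ∫ ω, X ω j * X ω j) := by
        rw [← integral_sub (hint i i) (hint j i), ← integral_sub (hint i j) (hint j j),
          ← integral_sub]
        · congr 1 with ω
          ring
        · exact (hint i i).sub (hint j i)
        · exact (hint i j).sub (hint j j)
      rw [hexpand]
      simpa [Matrix.mulVec_sub, sub_dotProduct, dotProduct_sub] using h
    refine tendsto_measureReal_both_gt_div (hXm i) (hXm j) hu hv (w := w) ?_ hne _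
      (fun b ω hω => ⟨i, hω⟩) (fun b ω hω => ⟨j, hω⟩)
    rw [← hw]
    congr 1 with ω
    simp [Pi.single_apply, add_mul, Finset.sum_add_distrib]
    ring
  let P := Finset.univ.filter fun p : Fin M × Fin M => p.1 ≠ p.2
  have hsum := tendsto_finsetSum P fun p hp => hpair p.1 p.2 (Finset.mem_filter.1 hp).2
  rw [Finset.sum_const_zero] at hsum
  refine squeeze_zero (fun b => by positivity) (fun b => ?_) hsum
  rw [← Finset.sum_div]
  refine div_le_div_of_nonneg_right ?_ ENNReal.toReal_nonneg
  refine le_trans (measureReal_mono ?_ (measure_ne_top _ _)) (measureReal_biUnion_finset_le P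
    fun p => {ω | X ω p.1 > b ∧ X ω p.2 > b})
  rintro ω ⟨i, j, hij, h⟩
  exact Set.mem_biUnion (x := (i, j)) (by simpa [P] using hij) h
end
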